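/- arXiv:quant-ph/0011122 — 4 statements merged into one kernel-verified Lean document; each statement's English description precedes it below -/
import Mathlib

section
/- There exists a universal cumulatively enumerable measure: there is a CEM μ₀ such that for every CEM μ there exists a constant c > 0 with μ₀(x) ≥ c·μ(x) for every finite binary string x. -/
open Filter Topology

/-- A (binary) semimeasure: `μ [] = 1`, nonnegative, and
`μ (x0) + μ (x1) ≤ μ x`. -/
def IsSemimeasure (μ : List Bool → ℝ) : Prop :=
  μ [] = 1 ∧ (∀ x, 0 ≤ μ x) ∧ ∀ x, μ (x ++ [false]) + μ (x ++ [true]) ≤ μ x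

/-- The deficiency `μ̄ x = μ x − μ (x0) − μ (x1)`. -/
noncomputable def mubar (μ : List Bool → ℝ) (x : List Bool) : ℝ :=
  μ x - μ (x ++ [false]) - μ (x ++ [true])

/-- Lexicographic order on finite binary strings: `x ≺ y` iff `x` is a proper
prefix of `y`, or at the first differing position `x` has bit 0 and `y` bit 1. -/
def lexLt : List Bool → List Bool → Prop
  | _, [] => False
  | [], _ :: _ => True
  | a :: x, b :: y => (a = false ∧ b = true) ∨ (a = b ∧ lexLt x y)

def lexLe (x y : List Bool) : Prop := lexLt x y ∨ x = y

/-- The cumulative measure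
`Cμ(x) = Σ_{|y| = |x|, y ⪰ x} μ(y) + Σ_{|y| < |x|, y ≻ x} μ̄(y)`. -/
noncomputable def Cmu (μ : List Bool → ℝ) (x : List Bool) : ℝ :=
  (∑' y : {y : List Bool // y.length = x.length ∧ lexLe x y}, μ y.1) +
  (∑' y : {y : List Bool // y.length < x.length ∧ lexLt x y}, mubar μ y.1)

/-- A cumulatively enumerable measure (CEM): a semimeasure whose cumulative
measure is uniformly enumerable from below by a computable `ℚ`-valued function. -/
def IsCEM (μ : List Bool → ℝ) : Prop :=
  IsSemimeasure μ ∧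
  ∃ g : List Bool → ℕ → ℚ, Computable₂ g ∧
    ∀ x, Monotone (g x) ∧
      Tendsto (fun t => ((g x t : ℚ) : ℝ)) atTop (𝓝 (Cmu μ x))

open Encodable Denumerable

abbrev ratCode (q : ℚ) : ℕ := @encode ℚ Rat.instEncodable q

theorem ratCode_eq (q : ℚ) : ratCode q = Nat.pair (encode q.num) q.den := by
  rfl

theorem ratCode_ofNat_lt (n : ℕ) : ratCode (ofNat ℚ n) < ratCode (ofNat ℚ (n + 1)) := by
  let := @decidableRangeEncode ℚ Rat.instEncodable
  let : Infinite (Set.range (@encode ℚ Rat.instEncodable)) :=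
    Infinite.of_injective _ (Equiv.ofInjective _ (@encode_injective ℚ Rat.instEncodable)).injective
  have key : ∀ n, ratCode (ofNat ℚ n) =
      (Nat.Subtype.ofNat (Set.range (@encode ℚ Rat.instEncodable)) n : ℕ) := by
    intro n
    have : ofNat ℚ n = (@equivRangeEncode ℚ Rat.instEncodable).symm
        (Nat.Subtype.ofNat (Set.range (@encode ℚ Rat.instEncodable)) n) := rfl
    rw [this]
    exact congrArg Subtype.val (Equiv.apply_symm_apply (@equivRangeEncode ℚ Rat.instEncodable) _)
  rw [key, key]
  exact Nat.Subtype.lt_succ_self _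

theorem Computable.of_strictMono {f : ℕ → ℕ} (hf : StrictMono f)
    (hr : PrimrecPred fun n => n ∈ Set.range f) : Computable f := by
  obtain ⟨hdec, hp⟩ := hr
  have hstep : Partrec₂ fun (_ : ℕ) (y : ℕ × ℕ) =>
      Nat.rfind fun m => Part.some (decide (y.2 < m) && decide (m ∈ Set.range f)) := by
    have hp' : Primrec fun z : (ℕ × ℕ × ℕ) × ℕ =>
        (decide (z.1.2.2 < z.2) && decide (z.2 ∈ Set.range f)) :=
      Primrec.and.comp
        (Primrec.nat_lt.decide.comp (Primrec.snd.comp (Primrec.snd.comp Primrec.fst))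
          Primrec.snd)
        (hp.comp Primrec.snd)
    exact (Partrec.rfind (p := fun (z : ℕ × ℕ × ℕ) m =>
      Part.some (decide (z.2.2 < m) && decide (m ∈ Set.range f))) hp'.to_comp.partrec).to₂
  refine (Partrec.nat_rec Computable.id (Computable.const (f 0)).partrec hstep).of_eq_tot
    fun n => ?_
  induction n with
  | zero => simp
  | succ n ih =>
    refine Part.mem_bind ih (Nat.mem_rfind.2 ⟨?_, fun {m} hm => ?_⟩)
    · simp [hf n.lt_succ_self]
    · rw [Part.mem_some_iff, eq_comm, ← Bool.not_eq_true, Bool.and_eq_true, decide_eq_true_iff,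
        decide_eq_true_iff]
      rintro ⟨h₁, k, rfl⟩
      have := hf.lt_iff_lt.1 h₁
      have := hf.lt_iff_lt.1 hm
      omega

theorem PrimrecRel.nat_dvd : PrimrecRel ((· ∣ ·) : ℕ → ℕ → Prop) :=
  (Primrec.eq.comp (Primrec.nat_mod.comp Primrec.snd Primrec.fst) (Primrec.const 0)).of_eq
    fun _ => (Nat.dvd_iff_mod_eq_zero).symm

theorem PrimrecRel.nat_coprime : PrimrecRel Nat.Coprime := by
  have hR : PrimrecRel fun (k : ℕ) (z : ℕ × ℕ) => ¬ (k ∣ z.1 ∧ k ∣ z.2) ∨ k = 1 :=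
    ((nat_dvd.comp Primrec.fst (Primrec.fst.comp Primrec.snd)).and
      (nat_dvd.comp Primrec.fst (Primrec.snd.comp Primrec.snd))).not.or
      (Primrec.eq.comp Primrec.fst (Primrec.const 1))
  refine (hR.forall_mem_list.comp (Primrec.list_range.comp (Primrec.succ.comp
    (Primrec.succ.comp (Primrec.nat_add.comp Primrec.fst Primrec.snd))))
    Primrec.id).of_eq fun ⟨a, b⟩ => ?_
  simp only [List.mem_range, id]
  constructor
  · intro h
    by_contra hab
    have hd := h (a.gcd b) ?_
    · rcases hd with hd | hd
      · exact hd ⟨Nat.gcd_dvd_left a b, Nat.gcd_dvd_right a b⟩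
      · exact hab hd
    · rcases Nat.eq_zero_or_pos a with rfl | ha
      · simp
      · have := Nat.gcd_le_left b ha
        omega
  · intro h k _
    by_cases hk : k ∣ a ∧ k ∣ b
    · exact Or.inr (Nat.eq_one_of_dvd_coprimes h hk.1 hk.2)
    · exact Or.inl hk

theorem int_natAbs_eq (z : ℤ) : z.natAbs = (encode z + 1) / 2 := by
  cases z with
  | ofNat n => change n = (2 * n + 1) / 2; omega
  | negSucc n => change n + 1 = (2 * n + 1 + 1) / 2; omega

theorem int_toNat_eq (z : ℤ) : z.toNat = if encode z % 2 = 0 then encode z / 2 else 0 := by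
  cases z with
  | ofNat n =>
    change n = if (2 * n) % 2 = 0 then (2 * n) / 2 else 0
    simp
  | negSucc n =>
    change 0 = if (2 * n + 1) % 2 = 0 then (2 * n + 1) / 2 else 0
    rw [if_neg (by omega)]

theorem mem_range_ratCode (n : ℕ) : n ∈ Set.range ratCode ↔
    0 < n.unpair.2 ∧ ((n.unpair.1 + 1) / 2).Coprime n.unpair.2 := by
  constructor
  · rintro ⟨q, rfl⟩
    rw [ratCode_eq, Nat.unpair_pair, ← int_natAbs_eq]
    exact ⟨q.pos, q.reduced⟩
  · rintro ⟨h₁, h₂⟩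
    have he : encode (ofNat ℤ n.unpair.1) = n.unpair.1 := encode_ofNat _
    refine ⟨⟨ofNat ℤ n.unpair.1, n.unpair.2, h₁.ne', ?_⟩, ?_⟩
    · rwa [int_natAbs_eq, he]
    · change Nat.pair (encode (ofNat ℤ n.unpair.1)) n.unpair.2 = n
      rw [he, Nat.pair_unpair]

theorem computable_ratCode : Computable ratCode := by
  have hD : Computable fun n => ratCode (ofNat ℚ n) := by
    refine Computable.of_strictMono (strictMono_nat_of_lt_succ ratCode_ofNat_lt) ?_
    have h : PrimrecPred fun n : ℕ =>
        0 < n.unpair.2 ∧ ((n.unpair.1 + 1) / 2).Coprime n.unpair.2 :=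
      (Primrec.nat_lt.comp (Primrec.const 0) (Primrec.snd.comp Primrec.unpair)).and
        (PrimrecRel.nat_coprime.comp
          (Primrec.nat_div.comp (Primrec.succ.comp (Primrec.fst.comp Primrec.unpair))
            (Primrec.const 2)) (Primrec.snd.comp Primrec.unpair))
    refine h.of_eq fun n => ?_
    rw [← mem_range_ratCode]
    constructor
    · rintro ⟨q, rfl⟩
      exact ⟨_, congrArg ratCode (ofNat_encode q)⟩
    · rintro ⟨k, rfl⟩
      exact ⟨_, rfl⟩
  refine (hD.comp Computable.encode).of_eq fun q => ?_
  rw [ofNat_encode]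

theorem computable_rat_den : Computable Rat.den :=
  (Computable.snd.comp (Computable.unpair.comp computable_ratCode)).of_eq fun q => by
    rw [ratCode_eq, Nat.unpair_pair]

theorem computable_rat_encode_num : Computable fun q : ℚ => encode q.num :=
  (Computable.fst.comp (Computable.unpair.comp computable_ratCode)).of_eq fun q => by
    rw [ratCode_eq, Nat.unpair_pair]

theorem computable_rat_num_toNat : Computable fun q : ℚ => q.num.toNat := by
  have h : Primrec fun n : ℕ => if n % 2 = 0 then n / 2 else 0 :=
    Primrec.ite (Primrec.eq.comp (Primrec.nat_mod.comp Primrec.id (Primrec.const 2))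
      (Primrec.const 0)) (Primrec.nat_div.comp Primrec.id (Primrec.const 2)) (Primrec.const 0)
  exact (h.to_comp.comp computable_rat_encode_num).of_eq fun q => (int_toNat_eq _).symm

theorem Computable.rat_natCast_div {α : Type*} [Primcodable α] {a b : α → ℕ}
    (ha : Computable a) (hb : Computable b) (hb₀ : ∀ x, 0 < b x) :
    Computable fun x => (a x : ℚ) / b x := by
  obtain ⟨F, hF, hF'⟩ : ∃ F : (ℕ × ℕ) × ℕ × ℕ × ℕ → Bool, Computable F ∧ ∀ a b c d e,
      F ((a, b), c, d, e) = true ↔ c % 2 = 0 ∧ d * b = a * e := by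
    refine ⟨fun z => decide (z.2.1 % 2 = 0) && decide (z.2.2.1 * z.1.2 = z.1.1 * z.2.2.2),
      (Primrec.and.comp
        (Primrec.eq.decide.comp (Primrec.nat_mod.comp (Primrec.fst.comp Primrec.snd)
          (Primrec.const 2)) (Primrec.const 0))
        (Primrec.eq.decide.comp
          (Primrec.nat_mul.comp (Primrec.fst.comp (Primrec.snd.comp Primrec.snd))
            (Primrec.snd.comp Primrec.fst))
          (Primrec.nat_mul.comp (Primrec.fst.comp Primrec.fst)
            (Primrec.snd.comp (Primrec.snd.comp Primrec.snd))))).to_comp, by simp⟩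
  let G (x : α) (q : ℚ) : Bool := F ((a x, b x), encode q.num, q.num.toNat, q.den)
  have hG : Computable₂ G :=
    hF.comp (((ha.comp Computable.fst).pair (hb.comp Computable.fst)).pair
      ((computable_rat_encode_num.comp Computable.snd).pair
        ((computable_rat_num_toNat.comp Computable.snd).pair
          (computable_rat_den.comp Computable.snd))))
  have hc : Computable₂ fun (x : α) (n : ℕ) => G x (ofNat ℚ n) :=
    hG.comp Computable.fst ((Computable.ofNat ℚ).comp Computable.snd)
  have key : ∀ x q, G x q = true ↔ q = (a x : ℚ) / b x := by
    intro x q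
    have hb' : (b x : ℚ) ≠ 0 := by exact_mod_cast (hb₀ x).ne'
    have hpar : encode q.num % 2 = 0 ↔ 0 ≤ q.num := by
      cases q.num with
      | ofNat n => change (2 * n) % 2 = 0 ↔ _; simp
      | negSucc n =>
        change (2 * n + 1) % 2 = 0 ↔ _
        have := Int.negSucc_lt_zero n
        omega
    rw [hF', hpar, eq_div_iff hb']
    have hq : q * b x = a x ↔ q.num * b x = a x * (q.den : ℤ) := by
      have hd : (q.den : ℚ) ≠ 0 := by exact_mod_cast q.den_nz
      conv_lhs => rw [← Rat.num_div_den q]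
      rw [div_mul_eq_mul_div, div_eq_iff hd]
      exact_mod_cast Iff.rfl
    rw [hq]
    constructor
    · rintro ⟨h₁, h₂⟩
      rw [← Int.toNat_of_nonneg h₁]
      exact_mod_cast h₂
    · intro h
      have h₁ : 0 ≤ q.num := by
        by_contra hn
        have h1 : q.num * (b x : ℤ) < 0 :=
          mul_neg_of_neg_of_pos (not_le.1 hn) (by exact_mod_cast hb₀ x)
        have h2 : (0 : ℤ) ≤ a x * (q.den : ℤ) := by positivity
        omega
      refine ⟨h₁, ?_⟩
      rw [← Int.toNat_of_nonneg h₁] at h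
      exact_mod_cast h
  refine Computable.encode_iff.1 ((Partrec.rfind hc.partrec₂).of_eq_tot fun x => ?_)
  refine Nat.mem_rfind.2 ⟨?_, fun {m} hm => ?_⟩
  · change true ∈ Part.some (G x (ofNat ℚ _))
    rw [Part.mem_some_iff, ofNat_encode]
    exact ((key x _).2 rfl).symm
  · change false ∈ Part.some (G x (ofNat ℚ _))
    rw [Part.mem_some_iff, eq_comm, ← Bool.not_eq_true, key]
    intro h
    rw [← h, encode_ofNat] at hm
    exact hm.false

/-- Decomposition of binary strings into the empty string and the strings with a given first bit. -/
def boolListEquiv : Unit ⊕ (List Bool ⊕ List Bool) ≃ List Bool where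
  toFun := Sum.elim (fun _ => []) (Sum.elim (List.cons false) (List.cons true))
  invFun
    | [] => .inl ()
    | false :: x => .inr (.inl x)
    | true :: x => .inr (.inr x)
  left_inv := by rintro (_ | _ | _) <;> rfl
  right_inv := by rintro (_ | ⟨_ | _, _⟩) <;> rfl

theorem summable_of_length_le {F : List Bool → ℝ} (n : ℕ) (hF : ∀ y, n < y.length → F y = 0) :
    Summable F := by
  refine summable_of_hasFiniteSupport ((List.finite_length_le Bool n).subset fun y hy => ?_)
  by_contra h
  exact hy (hF y (not_le.1 h))

theorem tsum_boolList {F : List Bool → ℝ} (n : ℕ) (hF : ∀ y, n < y.length → F y = 0) :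
    ∑' y, F y = F [] + (∑' y, F (false :: y) + ∑' y, F (true :: y)) := by
  have h (b : Bool) : Summable fun y => F (b :: y) :=
    summable_of_length_le n fun y hy => hF _ (hy.trans (Nat.lt_succ_self _))
  have hu : HasSum (fun _ : Unit => F []) (F []) := hasSum_unique _
  rw [← boolListEquiv.tsum_eq]
  exact (hu.sum ((h false).hasSum.sum (h true).hasSum (f := F ∘ boolListEquiv ∘ Sum.inr))
    (f := F ∘ boolListEquiv)).tsum_eq

open Classical in
/-- The summand of `y` in the cumulative measure of `x`. -/
noncomputable def cumulativeTerm (μ : List Bool → ℝ) (x y : List Bool) : ℝ :=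
  (if y.length = x.length ∧ lexLe x y then μ y else 0) +
    (if y.length < x.length ∧ lexLt x y then mubar μ y else 0)

theorem Cmu_eq_tsum (μ : List Bool → ℝ) (x : List Bool) :
    Cmu μ x = ∑' y, cumulativeTerm μ x y := by
  classical
  have h₁ := tsum_subtype {y : List Bool | y.length = x.length ∧ lexLe x y} μ
  have h₂ := tsum_subtype {y : List Bool | y.length < x.length ∧ lexLt x y} (mubar μ)
  unfold Cmu cumulativeTerm
  rw [Summable.tsum_add]
  · simp only [Set.indicator_apply, Set.mem_ofPred_eq] at h₁ h₂
    exact congrArg₂ (· + ·) h₁ h₂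
  · exact summable_of_length_le x.length fun y hy => if_neg fun h => hy.ne' h.1
  · exact summable_of_length_le x.length fun y hy => if_neg fun h => hy.not_gt h.1

theorem cumulativeTerm_of_length_lt (μ : List Bool → ℝ) (x y : List Bool)
    (h : x.length < y.length) : cumulativeTerm μ x y = 0 := by
  rw [cumulativeTerm, if_neg fun h' => h.ne' h'.1, if_neg fun h' => h.not_gt h'.1, add_zero]

theorem not_lexLt_nil (x : List Bool) : ¬ lexLt x [] := by
  cases x <;> exact id

theorem lexLt_cons (a b : Bool) (x y : List Bool) :
    lexLt (a :: x) (b :: y) ↔ a = false ∧ b = true ∨ a = b ∧ lexLt x y := Iff.rfl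

theorem lexLe_cons (a b : Bool) (x y : List Bool) :
    lexLe (a :: x) (b :: y) ↔ a = false ∧ b = true ∨ a = b ∧ lexLe x y := by
  simp only [lexLe, lexLt_cons, List.cons.injEq]
  tauto

theorem lexLe_nil_iff (x : List Bool) : lexLe x [] ↔ x = [] := by
  simp [lexLe, not_lexLt_nil]

theorem nil_lexLe (x : List Bool) : lexLe [] x := by
  cases x with
  | nil => exact Or.inr rfl
  | cons => exact Or.inl trivial

theorem mubar_cons (μ : List Bool → ℝ) (b : Bool) (y : List Bool) :
    mubar μ (b :: y) = mubar (fun z => μ (b :: z)) y := rfl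

open Classical in
/-- The mass of all strings, truncated at length `n`, is the mass of the empty string. -/
theorem tsum_total (n : ℕ) (μ : List Bool → ℝ) :
    ∑' y : List Bool, ((if y.length = n then μ y else 0) +
      (if y.length < n then mubar μ y else 0)) = μ [] := by
  induction n generalizing μ with
  | zero =>
    rw [tsum_eq_single []]
    · simp
    · intro y hy
      simp [hy]
  | succ n ih =>
    rw [tsum_boolList (n + 1)]
    · simp only [List.length_cons, Nat.add_right_cancel_iff, Nat.add_lt_add_iff_right, mubar_cons]
      rw [ih fun z => μ (false :: z), ih fun z => μ (true :: z)]
      simp [mubar]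
    · intro y hy
      rw [if_neg hy.ne', if_neg hy.not_gt, add_zero]

theorem Cmu_nil (μ : List Bool → ℝ) : Cmu μ [] = μ [] := by
  rw [Cmu_eq_tsum, tsum_eq_single []]
  · simp [cumulativeTerm, lexLe]
  · intro y hy
    exact cumulativeTerm_of_length_lt _ _ _ (List.length_pos_iff.2 hy)

theorem cumulativeTerm_nil (μ : List Bool → ℝ) (a : Bool) (x : List Bool) :
    cumulativeTerm μ (a :: x) [] = 0 := by
  simp [cumulativeTerm, not_lexLt_nil]

open Classical in
theorem cumulativeTerm_cons_self (μ : List Bool → ℝ) (a : Bool) (x y : List Bool) :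
    cumulativeTerm μ (a :: x) (a :: y) = cumulativeTerm (fun z => μ (a :: z)) x y := by
  refine congrArg₂ (· + ·) (if_congr ?_ rfl rfl) (if_congr ?_ rfl rfl) <;>
    cases a <;> simp [lexLt_cons, lexLe_cons]

theorem cumulativeTerm_true_false (μ : List Bool → ℝ) (x y : List Bool) :
    cumulativeTerm μ (true :: x) (false :: y) = 0 := by
  rw [cumulativeTerm, if_neg (by simp [lexLe_cons]), if_neg (by simp [lexLt_cons]), add_zero]

open Classical in
theorem cumulativeTerm_false_true (μ : List Bool → ℝ) (x y : List Bool) :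
    cumulativeTerm μ (false :: x) (true :: y) = (if y.length = x.length then μ (true :: y) else 0) +
      (if y.length < x.length then mubar (fun z => μ (true :: z)) y else 0) := by
  refine congrArg₂ (· + ·) (if_congr ?_ rfl rfl) (if_congr ?_ rfl rfl) <;>
    simp [lexLt_cons, lexLe_cons]

theorem Cmu_true_cons (μ : List Bool → ℝ) (x : List Bool) :
    Cmu μ (true :: x) = Cmu (fun y => μ (true :: y)) x := by
  rw [Cmu_eq_tsum, tsum_boolList _ (cumulativeTerm_of_length_lt _ _), Cmu_eq_tsum]
  simp [cumulativeTerm_nil, cumulativeTerm_cons_self, cumulativeTerm_true_false]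

theorem Cmu_false_cons (μ : List Bool → ℝ) (x : List Bool) :
    Cmu μ (false :: x) = Cmu (fun y => μ (false :: y)) x + μ [true] := by
  rw [Cmu_eq_tsum, tsum_boolList _ (cumulativeTerm_of_length_lt _ _), Cmu_eq_tsum]
  simp [cumulativeTerm_nil, cumulativeTerm_cons_self, cumulativeTerm_false_true, tsum_total]

theorem Cmu_nonneg {μ : List Bool → ℝ} (hμ : ∀ x, 0 ≤ μ x) (x : List Bool) : 0 ≤ Cmu μ x := by
  induction x generalizing μ with
  | nil => rw [Cmu_nil]; exact hμ _
  | cons a x ih =>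
    cases a with
    | true => rw [Cmu_true_cons]; exact ih fun _ => hμ _
    | false => rw [Cmu_false_cons]; exact add_nonneg (ih fun _ => hμ _) (hμ _)

theorem Cmu_le_nil {μ : List Bool → ℝ} (hμ : ∀ x, 0 ≤ μ x)
    (hadd : ∀ x, μ (x ++ [false]) + μ (x ++ [true]) ≤ μ x) (x : List Bool) :
    Cmu μ x ≤ μ [] := by
  induction x generalizing μ with
  | nil => rw [Cmu_nil]
  | cons a x ih =>
    have h₀ : μ [false] + μ [true] ≤ μ [] := hadd []
    have h := ih (μ := fun y => μ (a :: y)) (fun _ => hμ _) fun y => hadd (a :: y)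
    cases a with
    | true => rw [Cmu_true_cons]; linarith [hμ [false]]
    | false => rw [Cmu_false_cons]; linarith

theorem Cmu_antitone {μ : List Bool → ℝ} (hμ : ∀ x, 0 ≤ μ x)
    (hadd : ∀ x, μ (x ++ [false]) + μ (x ++ [true]) ≤ μ x) {x y : List Bool} (hxy : lexLe x y) :
    Cmu μ y ≤ Cmu μ x := by
  induction x generalizing μ y with
  | nil => rw [Cmu_nil]; exact Cmu_le_nil hμ hadd y
  | cons a x ih =>
    cases y with
    | nil => simp [lexLe_nil_iff] at hxy
    | cons b y =>
      obtain ⟨rfl, rfl⟩ | ⟨rfl, h⟩ := (lexLe_cons _ _ _ _).1 hxy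
      · rw [Cmu_true_cons, Cmu_false_cons]
        exact (Cmu_le_nil (fun _ => hμ _) (fun z => hadd (true :: z)) y).trans
          (le_add_of_nonneg_left (Cmu_nonneg (fun _ => hμ _) _))
      · have h := ih (μ := fun y => μ (a :: y)) (fun _ => hμ _) (fun z => hadd (a :: z)) h
        cases a with
        | true => rwa [Cmu_true_cons, Cmu_true_cons]
        | false => rw [Cmu_false_cons, Cmu_false_cons]; linarith

/-- The function `μ` whose cumulative measure is `fun x => C x - e`: the value at `x` is the
decrease of `C` from `x` to the first string above all extensions of `x`, with the value `e` if
there is no such string. -/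
noncomputable def ofCumulative : List Bool → (List Bool → ℝ) → ℝ → ℝ
  | [], C, e => C [] - e
  | true :: x, C, e => ofCumulative x (fun y => C (true :: y)) e
  | false :: x, C, _ => ofCumulative x (fun y => C (false :: y)) (C [true])

theorem Cmu_ofCumulative (C : List Bool → ℝ) (e : ℝ) (x : List Bool) :
    Cmu (fun y => ofCumulative y C e) x = C x - e := by
  induction x generalizing C e with
  | nil => rw [Cmu_nil]; rfl
  | cons a x ih =>
    cases a with
    | true => rw [Cmu_true_cons]; exact ih _ _
    | false =>
      rw [Cmu_false_cons]
      have := ih (fun y => C (false :: y)) (C [true])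
      simp only [ofCumulative]
      rw [this]
      ring

theorem ofCumulative_Cmu (μ : List Bool → ℝ) (e : ℝ) (x : List Bool) :
    ofCumulative x (fun y => Cmu μ y + e) e = μ x := by
  induction x generalizing μ e with
  | nil => simp [ofCumulative, Cmu_nil]
  | cons a x ih =>
    cases a with
    | true =>
      simp only [ofCumulative, Cmu_true_cons]
      exact ih (fun y => μ (true :: y)) e
    | false =>
      simp only [ofCumulative, Cmu_true_cons, Cmu_false_cons, Cmu_nil]
      simpa only [add_assoc] using ih (fun y => μ (false :: y)) (μ [true] + e)

theorem ofCumulative_nonneg {C : List Bool → ℝ} (hC : ∀ x y, lexLe x y → C y ≤ C x) {e : ℝ}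
    (he : ∀ x, e ≤ C x) (x : List Bool) : 0 ≤ ofCumulative x C e := by
  induction x generalizing C e with
  | nil => exact sub_nonneg.2 (he _)
  | cons a x ih =>
    cases a with
    | true =>
      exact ih (fun x y h => hC _ _ ((lexLe_cons _ _ _ _).2 (Or.inr ⟨rfl, h⟩))) fun _ => he _
    | false =>
      exact ih (fun x y h => hC _ _ ((lexLe_cons _ _ _ _).2 (Or.inr ⟨rfl, h⟩))) fun _ =>
        hC _ _ ((lexLe_cons _ _ _ _).2 (Or.inl ⟨rfl, rfl⟩))

theorem ofCumulative_append_le {C : List Bool → ℝ} (hC : ∀ x y, lexLe x y → C y ≤ C x) (e : ℝ)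
    (x : List Bool) :
    ofCumulative (x ++ [false]) C e + ofCumulative (x ++ [true]) C e ≤ ofCumulative x C e := by
  induction x generalizing C e with
  | nil =>
    have := hC [] [false] (nil_lexLe _)
    simp only [List.nil_append, ofCumulative]
    linarith
  | cons a x ih =>
    cases a <;>
      exact ih (fun x y h => hC _ _ ((lexLe_cons _ _ _ _).2 (Or.inr ⟨rfl, h⟩))) _

theorem ofCumulative_add_smul (w : ℝ) (C D : List Bool → ℝ) (d e : ℝ) (x : List Bool) :
    ofCumulative x (fun y => w * C y + D y) (w * d + e) =
      w * ofCumulative x C d + ofCumulative x D e := by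
  induction x generalizing C D d e with
  | nil => simp only [ofCumulative]; ring
  | cons a x ih => cases a <;> exact ih _ _ _ _

theorem isSemimeasure_ofCumulative {C : List Bool → ℝ} (h₁ : C [] = 1) (h₀ : ∀ x, 0 ≤ C x)
    (hC : ∀ x y, lexLe x y → C y ≤ C x) : IsSemimeasure fun x => ofCumulative x C 0 :=
  ⟨by simp [ofCumulative, h₁], ofCumulative_nonneg hC h₀, ofCumulative_append_le hC 0⟩

theorem lexLe_trans {x y z : List Bool} (hxy : lexLe x y) (hyz : lexLe y z) : lexLe x z := by
  induction x generalizing y z with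
  | nil => exact nil_lexLe z
  | cons a x ih =>
    cases y with
    | nil => simp [lexLe_nil_iff] at hxy
    | cons b y =>
      cases z with
      | nil => simp [lexLe_nil_iff] at hyz
      | cons c z =>
        rw [lexLe_cons] at *
        rcases hxy with ⟨rfl, rfl⟩ | ⟨rfl, hxy⟩ <;> rcases hyz with ⟨h, rfl⟩ | ⟨rfl, hyz⟩
        · exact Or.inl ⟨rfl, rfl⟩
        · exact Or.inl ⟨rfl, rfl⟩
        · exact Or.inl ⟨h, rfl⟩
        · exact Or.inr ⟨rfl, ih hxy hyz⟩

/-- One step of the comparison of two strings: the state is the unread part of the second string,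
together with the result as soon as it is known. -/
def lexStep (s : List Bool × Option Bool) (a : Bool) : List Bool × Option Bool :=
  Option.casesOn s.2
    (List.casesOn s.1 ([], some false) fun b y => if a = b then (y, none) else (y, some b))
    fun r => (s.1, some r)

theorem foldl_lexStep_some (x y : List Bool) (r : Bool) :
    x.foldl lexStep (y, some r) = (y, some r) := by
  induction x with
  | nil => rfl
  | cons a x ih => exact ih

theorem foldl_lexStep_iff (x y : List Bool) :
    (x.foldl lexStep (y, none)).2.getD true = true ↔ lexLe x y := by
  induction x generalizing y with
  | nil => simp [nil_lexLe]
  | cons a x ih =>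
    cases y with
    | nil => simp [lexStep, foldl_lexStep_some, lexLe_nil_iff]
    | cons b y =>
      rw [lexLe_cons, List.foldl_cons]
      by_cases h : a = b
      · simp [lexStep, h, ih]
      · cases a <;> cases b <;> simp_all [lexStep, foldl_lexStep_some]

theorem primrecRel_lexLe : PrimrecRel lexLe := by
  have hstep : Primrec₂ lexStep := by
    have hs : Primrec fun p : (List Bool × Option Bool) × Bool => p.1 := Primrec.fst
    refine Primrec.option_casesOn (Primrec.snd.comp hs)
      (Primrec.list_casesOn
        (h := fun p q => if p.2 = q.1 then (q.2, none) else (q.2, some q.1))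
        (Primrec.fst.comp hs) (Primrec.const ([], some false)) ?_)
      ((Primrec.fst.comp (hs.comp Primrec.fst)).pair (Primrec.option_some.comp Primrec.snd))
    exact Primrec.ite
      (Primrec.eq.comp (Primrec.snd.comp Primrec.fst) (Primrec.fst.comp Primrec.snd))
      ((Primrec.snd.comp Primrec.snd).pair (Primrec.const none))
      ((Primrec.snd.comp Primrec.snd).pair
        (Primrec.option_some.comp (Primrec.fst.comp Primrec.snd)))
  have h : Primrec fun p : List Bool × List Bool =>
      (p.1.foldl lexStep (p.2, none)).2.getD true :=
    Primrec.option_getD.comp (Primrec.snd.comp (Primrec.list_foldl Primrec.fst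
      (Primrec.snd.pair (Primrec.const none)) (hstep.comp₂
        (Primrec.fst.comp₂ Primrec₂.right) (Primrec.snd.comp₂ Primrec₂.right))))
      (Primrec.const true)
  have h' : PrimrecPred fun p : List Bool × List Bool =>
      (p.1.foldl lexStep (p.2, none)).2.getD true = true :=
    Primrec.eq.comp h (Primrec.const true)
  exact h'.of_eq fun p => foldl_lexStep_iff p.1 p.2

theorem Primrec.finset_sum_range {α : Type*} [Primcodable α] {f : α → ℕ → ℕ} {g : α → ℕ}
    (hf : Primrec₂ f) (hg : Primrec g) : Primrec fun a => ∑ i ∈ Finset.range (g a), f a i := by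
  have h : Primrec₂ fun (a : α) (p : ℕ × ℕ) => p.2 + f a p.1 :=
    Primrec.nat_add.comp (Primrec.snd.comp Primrec.snd)
      (hf.comp Primrec.fst (Primrec.fst.comp Primrec.snd))
  refine (Primrec.nat_rec' hg (Primrec.const 0) h).of_eq fun a => ?_
  induction g a with
  | zero => rfl
  | succ n ih => rw [Finset.sum_range_succ, ← ih]

theorem Primrec.finset_sup_range {α : Type*} [Primcodable α] {f : α → ℕ → ℕ} {g : α → ℕ}
    (hf : Primrec₂ f) (hg : Primrec g) : Primrec fun a => (Finset.range (g a)).sup (f a) := by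
  have h : Primrec₂ fun (a : α) (p : ℕ × ℕ) => max (f a p.1) p.2 :=
    Primrec.nat_max.comp (hf.comp Primrec.fst (Primrec.fst.comp Primrec.snd))
      (Primrec.snd.comp Primrec.snd)
  refine (Primrec.nat_rec' hg (Primrec.const 0) h).of_eq fun a => ?_
  induction g a with
  | zero => rfl
  | succ n ih => rw [Finset.range_add_one, Finset.sup_insert, ← ih]

theorem Primrec.nat_two_pow : Primrec fun n : ℕ => 2 ^ n :=
  (Primrec₂.unpaired'.1 Nat.Primrec.pow).comp (Primrec.const 2) Primrec.id

open Nat.Partrec (Code)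
open Nat.Partrec.Code (evaln evaln_mono evaln_sound evaln_complete evaln_bound)

open Classical in
/-- If the `e`-th program outputs `m` on the input `i = ⟨z, t⟩` within `s` steps and `x ⪯ z`, this
is `2 ^ s` times the number `m / 2 ^ t` truncated to at most `1`; otherwise it is zero. -/
noncomputable def stageTerm (e s : ℕ) (x : List Bool) (i : ℕ) : ℕ :=
  ((evaln s (ofNat Code e) i).bind fun m => (decode (α := List Bool) i.unpair.1).map fun z =>
    if lexLe x z then min (m * 2 ^ (s - i.unpair.2)) (2 ^ s) else 0).getD 0

/-- The `s`-th approximation, scaled by `2 ^ s`, of the decreasing function enumerated by the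
`e`-th program. -/
noncomputable def stage (e s : ℕ) (x : List Bool) : ℕ :=
  if x = [] then 2 ^ s else (Finset.range s).sup (stageTerm e s x)

theorem primrec_stage : Primrec fun p : (ℕ × ℕ) × List Bool => stage p.1.1 p.1.2 p.2 := by
  classical
  have hpow {α : Type} [Primcodable α] {f : α → ℕ} (hf : Primrec f) :
      Primrec fun a => 2 ^ f a := Primrec.nat_two_pow.comp hf
  refine Primrec.ite (Primrec.eq.comp Primrec.snd (Primrec.const []))
    (hpow (Primrec.snd.comp Primrec.fst)) ?_
  refine Primrec.finset_sup_range ?_ (Primrec.snd.comp Primrec.fst)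
  have hs : Primrec fun p : ((ℕ × ℕ) × List Bool) × ℕ => p.1.1.2 :=
    Primrec.snd.comp (Primrec.fst.comp Primrec.fst)
  have hev : Primrec fun p : ((ℕ × ℕ) × List Bool) × ℕ =>
      evaln p.1.1.2 (ofNat Code p.1.1.1) p.2 :=
    Nat.Partrec.Code.primrec_evaln.comp ((hs.pair ((Primrec.ofNat Code).comp
      (Primrec.fst.comp (Primrec.fst.comp Primrec.fst)))).pair Primrec.snd)
  have hval : Primrec₂ fun (p : (((ℕ × ℕ) × List Bool) × ℕ) × ℕ) (z : List Bool) =>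
      if lexLe p.1.1.2 z then min (p.2 * 2 ^ (p.1.1.1.2 - p.1.2.unpair.2)) (2 ^ p.1.1.1.2)
        else 0 := by
    have h₁ : Primrec fun q : ((((ℕ × ℕ) × List Bool) × ℕ) × ℕ) × List Bool => q.1.1 :=
      Primrec.fst.comp Primrec.fst
    refine Primrec.ite (primrecRel_lexLe.comp (Primrec.snd.comp (Primrec.fst.comp h₁)) Primrec.snd)
      (Primrec.nat_min.comp (Primrec.nat_mul.comp (Primrec.snd.comp Primrec.fst)
        (hpow (Primrec.nat_sub.comp (hs.comp h₁)
          (Primrec.snd.comp (Primrec.unpair.comp (Primrec.snd.comp h₁))))))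
        (hpow (hs.comp h₁))) (Primrec.const 0)
  have hdec : Primrec fun p : (((ℕ × ℕ) × List Bool) × ℕ) × ℕ =>
      decode (α := List Bool) p.1.2.unpair.1 :=
    Primrec.decode.comp (Primrec.fst.comp (Primrec.unpair.comp (Primrec.snd.comp Primrec.fst)))
  exact Primrec.option_getD.comp (Primrec.option_bind hev (Primrec.option_map hdec hval))
    (Primrec.const 0)

theorem stageTerm_le (e s : ℕ) (x : List Bool) (i : ℕ) : stageTerm e s x i ≤ 2 ^ s := by
  unfold stageTerm
  cases evaln s (ofNat Code e) i with
  | none => simp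
  | some m =>
    cases decode (α := List Bool) i.unpair.1 with
    | none => simp
    | some z =>
      simp only [Option.bind_some, Option.map_some, Option.getD_some]
      split_ifs <;> simp

theorem stageTerm_antitone (e s i : ℕ) {x y : List Bool} (h : lexLe x y) :
    stageTerm e s y i ≤ stageTerm e s x i := by
  unfold stageTerm
  cases evaln s (ofNat Code e) i with
  | none => simp
  | some m =>
    cases decode (α := List Bool) i.unpair.1 with
    | none => simp
    | some z =>
      simp only [Option.bind_some, Option.map_some, Option.getD_some]
      by_cases hz : lexLe y z
      · rw [if_pos hz, if_pos (lexLe_trans h hz)]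
      · rw [if_neg hz]
        exact Nat.zero_le _

theorem two_mul_stageTerm_le (e s i : ℕ) (x : List Bool) :
    2 * stageTerm e s x i ≤ stageTerm e (s + 1) x i := by
  unfold stageTerm
  cases h : evaln s (ofNat Code e) i with
  | none => simp
  | some m =>
    have hi : i < s := evaln_bound h
    rw [evaln_mono s.le_succ h]
    cases decode (α := List Bool) i.unpair.1 with
    | none => simp
    | some z =>
      simp only [Option.bind_some, Option.map_some, Option.getD_some]
      have hs : s + 1 - i.unpair.2 = s - i.unpair.2 + 1 :=
        Nat.succ_sub ((Nat.unpair_right_le i).trans hi.le)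
      split_ifs with hz
      · rw [hs, pow_succ, pow_succ, ← mul_assoc]
        omega
      · simp

theorem stage_nil (e s : ℕ) : stage e s [] = 2 ^ s := if_pos rfl

theorem stage_le (e s : ℕ) (x : List Bool) : stage e s x ≤ 2 ^ s := by
  unfold stage
  split_ifs
  · rfl
  · exact Finset.sup_le fun i _ => stageTerm_le e s x i

theorem stage_antitone (e s : ℕ) {x y : List Bool} (h : lexLe x y) :
    stage e s y ≤ stage e s x := by
  by_cases hx : x = []
  · rw [hx, stage_nil]
    exact stage_le e s y
  · have hy : y ≠ [] := fun hy => hx ((lexLe_nil_iff x).1 (hy ▸ h))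
    rw [stage, stage, if_neg hx, if_neg hy]
    exact Finset.sup_mono_fun fun i _ => stageTerm_antitone e s i h

theorem two_mul_stage_le (e s : ℕ) (x : List Bool) : 2 * stage e s x ≤ stage e (s + 1) x := by
  unfold stage
  split_ifs
  · rw [pow_succ, mul_comm]
  · rw [mul_comm, ← Nat.le_div_iff_mul_le two_pos]
    refine Finset.sup_le fun i hi => ?_
    rw [Nat.le_div_iff_mul_le two_pos, mul_comm]
    exact (two_mul_stageTerm_le e s i x).trans (Finset.le_sup (f := stageTerm e (s + 1) x)
      (Finset.mem_range.2 ((Finset.mem_range.1 hi).trans s.lt_succ_self)))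

/-- The `s`-th approximation of the decreasing function enumerated by the `e`-th program. -/
noncomputable def approx (e : ℕ) (x : List Bool) (s : ℕ) : ℝ := stage e s x / 2 ^ s

theorem approx_nonneg (e : ℕ) (x : List Bool) (s : ℕ) : 0 ≤ approx e x s := by
  unfold approx; positivity

theorem approx_le_one (e : ℕ) (x : List Bool) (s : ℕ) : approx e x s ≤ 1 :=
  div_le_one_of_le₀ (by exact_mod_cast stage_le e s x) (by positivity)

theorem approx_nil (e s : ℕ) : approx e [] s = 1 := by
  simp [approx, stage_nil]

theorem approx_antitone (e s : ℕ) {x y : List Bool} (h : lexLe x y) :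
    approx e y s ≤ approx e x s :=
  div_le_div_of_nonneg_right (by exact_mod_cast stage_antitone e s h) (by positivity)

theorem approx_monotone (e : ℕ) (x : List Bool) : Monotone (approx e x) := by
  refine monotone_nat_of_le_succ fun s => ?_
  have h : (2 : ℝ) * stage e s x ≤ stage e (s + 1) x := by exact_mod_cast two_mul_stage_le e s x
  unfold approx
  rw [div_le_div_iff₀ (by positivity) (by positivity), pow_succ]
  have := mul_le_mul_of_nonneg_right h (by positivity : (0 : ℝ) ≤ 2 ^ s)
  linarith

/-- The decreasing function enumerated by the `e`-th program. -/
noncomputable def enumerated (e : ℕ) (x : List Bool) : ℝ := ⨆ s, approx e x s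

theorem approx_bddAbove (e : ℕ) (x : List Bool) : BddAbove (Set.range (approx e x)) :=
  ⟨1, by rintro _ ⟨s, rfl⟩; exact approx_le_one e x s⟩

theorem approx_le_enumerated (e : ℕ) (x : List Bool) (s : ℕ) : approx e x s ≤ enumerated e x :=
  le_ciSup (approx_bddAbove e x) s

theorem tendsto_approx (e : ℕ) (x : List Bool) :
    Tendsto (approx e x) atTop (𝓝 (enumerated e x)) :=
  tendsto_atTop_ciSup (approx_monotone e x) (approx_bddAbove e x)

theorem enumerated_nonneg (e : ℕ) (x : List Bool) : 0 ≤ enumerated e x :=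
  (approx_nonneg e x 0).trans (approx_le_enumerated e x 0)

theorem enumerated_le_one (e : ℕ) (x : List Bool) : enumerated e x ≤ 1 :=
  ciSup_le (approx_le_one e x)

theorem enumerated_nil (e : ℕ) : enumerated e [] = 1 := by
  simp [enumerated, approx_nil]

theorem enumerated_antitone (e : ℕ) {x y : List Bool} (h : lexLe x y) :
    enumerated e y ≤ enumerated e x :=
  ciSup_mono (approx_bddAbove e x) fun s => approx_antitone e s h

/-- Every cumulative measure that is enumerable from below is enumerated by some program. -/
theorem exists_enumerated_eq {C : List Bool → ℝ} (hnil : C [] = 1) (h₀ : ∀ x, 0 ≤ C x)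
    (hC : ∀ x y, lexLe x y → C y ≤ C x) {g : List Bool → ℕ → ℚ} (hg : Computable₂ g)
    (hmono : ∀ x, Monotone (g x))
    (hlim : ∀ x, Tendsto (fun t => ((g x t : ℚ) : ℝ)) atTop (𝓝 (C x))) :
    ∃ e, ∀ x, enumerated e x = C x := by
  have hle (x : List Bool) (t : ℕ) : (g x t : ℝ) ≤ C x :=
    Monotone.ge_of_tendsto (fun a b hab => Rat.cast_le.2 (hmono x hab)) (hlim x) t
  let f (p : List Bool × ℕ) : ℕ := (g p.1 p.2).num.toNat * 2 ^ p.2 / (g p.1 p.2).den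
  have hf : Computable f :=
    Primrec.nat_div.to_comp.comp
      (Primrec.nat_mul.to_comp.comp (computable_rat_num_toNat.comp hg)
        (Primrec.nat_two_pow.to_comp.comp Computable.snd)) (computable_rat_den.comp hg)
  have hf_le (z : List Bool) (t : ℕ) : (f (z, t) : ℝ) ≤ C z * 2 ^ t := by
    have hd : (0 : ℝ) < (g z t).den := by exact_mod_cast (g z t).pos
    refine (Nat.cast_div_le (α := ℝ)).trans ?_
    rw [div_le_iff₀ hd]
    push_cast
    have hnum : (((g z t).num.toNat : ℕ) : ℝ) ≤ C z * (g z t).den := by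
      rcases le_total 0 (g z t).num with h | h
      · have h1 : (((g z t).num.toNat : ℕ) : ℝ) = (g z t : ℝ) * (g z t).den := by
          have h2 : (((g z t).num.toNat : ℤ) : ℝ) = (g z t).num := by rw [Int.toNat_of_nonneg h]
          have h3 := Rat.mul_den_eq_num (g z t)
          have h4 : (g z t : ℝ) * (g z t).den = (g z t).num := by exact_mod_cast h3
          rw [h4]
          exact_mod_cast h2
        rw [h1]
        exact mul_le_mul_of_nonneg_right (hle z t) hd.le
      · rw [Int.toNat_of_nonpos h]
        simpa using mul_nonneg (h₀ z) hd.le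
    calc _ ≤ C z * (g z t).den * 2 ^ t := mul_le_mul_of_nonneg_right hnum (by positivity)
      _ = _ := by ring
  have hf_ge (z : List Bool) (t : ℕ) : (g z t : ℝ) * 2 ^ t - 1 ≤ f (z, t) := by
    have hd : (0 : ℝ) < (g z t).den := by exact_mod_cast (g z t).pos
    have h1 : (g z t).num.toNat * 2 ^ t < (f (z, t) + 1) * (g z t).den :=
      (Nat.div_lt_iff_lt_mul (g z t).pos).1 (Nat.lt_succ_self _)
    have h2 : (((g z t).num.toNat : ℕ) : ℝ) * 2 ^ t < (f (z, t) + 1) * (g z t).den := by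
      exact_mod_cast h1
    have h3 : ((g z t).num : ℝ) ≤ (((g z t).num.toNat : ℕ) : ℝ) := by
      exact_mod_cast Int.self_le_toNat (g z t).num
    have h4 : (g z t : ℝ) * (g z t).den = (g z t).num := by
      exact_mod_cast Rat.mul_den_eq_num (g z t)
    have h5 := mul_le_mul_of_nonneg_right h3 (by positivity : (0 : ℝ) ≤ 2 ^ t)
    have h6 : (g z t : ℝ) * 2 ^ t * (g z t).den < (f (z, t) + 1) * (g z t).den := by
      calc _ = (g z t).num * (2 : ℝ) ^ t := by rw [← h4]; ring
        _ < _ := h5.trans_lt h2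
    linarith [lt_of_mul_lt_mul_right h6 hd.le]
  obtain ⟨c, hc⟩ := Nat.Partrec.Code.exists_code.1 hf.partrec
  have heval (z : List Bool) (t : ℕ) : c.eval (encode (z, t)) = Part.some (f (z, t)) := by
    simp [hc]
  have hterm (x : List Bool) (s i : ℕ) :
      (stageTerm (encode c) s x i : ℝ) ≤ C x * 2 ^ s := by
    unfold stageTerm
    have hpos : (0 : ℝ) ≤ C x * 2 ^ s := mul_nonneg (h₀ x) (by positivity)
    rw [ofNat_encode]
    cases hm : evaln s c i with
    | none => simpa using hpos
    | some m =>
      cases hz : decode (α := List Bool) i.unpair.1 with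
      | none => simpa using hpos
      | some z =>
        simp only [Option.bind_some, Option.map_some, Option.getD_some]
        have hi : i < s := evaln_bound hm
        have hts : i.unpair.2 ≤ s := (Nat.unpair_right_le i).trans hi.le
        have hmf : f (z, i.unpair.2) = m := by
          have h1 : m ∈ c.eval i := evaln_sound hm
          rw [hc] at h1
          have h2 : decode (α := List Bool × ℕ) i = some (z, i.unpair.2) := by
            simp [decode_prod_val, hz]
          simpa [h2, eq_comm] using h1
        split_ifs with hxz
        · have h1 := hf_le z i.unpair.2
          rw [hmf] at h1
          have h2 : (m : ℝ) * 2 ^ (s - i.unpair.2) ≤ C z * 2 ^ s := by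
            calc _ ≤ C z * 2 ^ i.unpair.2 * 2 ^ (s - i.unpair.2) :=
                  mul_le_mul_of_nonneg_right h1 (by positivity)
              _ = C z * 2 ^ s := by rw [mul_assoc, ← pow_add, Nat.add_sub_cancel' hts]
          have h3 : C z * 2 ^ s ≤ C x * 2 ^ s :=
            mul_le_mul_of_nonneg_right (hC _ _ hxz) (by positivity)
          refine le_trans ?_ (h2.trans h3)
          exact_mod_cast min_le_left _ _
        · simpa using hpos
  refine ⟨encode c, fun x => ?_⟩
  by_cases hx : x = []
  · rw [hx, enumerated_nil, hnil]
  refine le_antisymm (ciSup_le fun s => ?_) ?_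
  · have h2s : (0 : ℝ) < 2 ^ s := by positivity
    rw [approx, div_le_iff₀ h2s, stage, if_neg hx]
    refine Finset.sup_induction (p := fun n : ℕ => (n : ℝ) ≤ C x * 2 ^ s) ?_ ?_
      fun i _ => hterm x s i
    · simpa using mul_nonneg (h₀ x) h2s.le
    · intro a ha b hb
      rcases max_choice a b with h | h
      · rwa [← h] at ha
      · rwa [← h] at hb
  · have hlow (t : ℕ) : (g x t : ℝ) - (1 / 2) ^ t ≤ enumerated (encode c) x := by
      have hmem : f (x, t) ∈ c.eval (encode (x, t)) := by
        rw [heval]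
        exact Part.mem_some _
      obtain ⟨s, hs⟩ := evaln_complete.1 hmem
      have hi : encode (x, t) < s := evaln_bound hs
      have hu : (encode (x, t)).unpair = (encode x, t) := by
        simp [encode_prod_val]
      have hts : t ≤ s := by
        have := Nat.unpair_right_le (encode (x, t))
        rw [hu] at this
        exact this.trans hi.le
      refine le_trans ?_ (approx_le_enumerated _ _ s)
      have hst : stageTerm (encode c) s x (encode (x, t)) = f (x, t) * 2 ^ (s - t) := by
        unfold stageTerm
        rw [ofNat_encode, Option.mem_def.1 hs, hu]
        simp only [Option.bind_some, encodek, Option.map_some, Option.getD_some]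
        rw [if_pos (show lexLe x x from Or.inr rfl), min_eq_left]
        have h1 : (f (x, t) : ℝ) ≤ 2 ^ t :=
          (hf_le x t).trans (mul_le_of_le_one_left (by positivity) (hnil ▸ hC _ _ (nil_lexLe x)))
        have h2 : f (x, t) ≤ 2 ^ t := by exact_mod_cast h1
        calc _ ≤ 2 ^ t * 2 ^ (s - t) := Nat.mul_le_mul_right _ h2
          _ = 2 ^ s := by rw [← pow_add, Nat.add_sub_cancel' hts]
      have hge : f (x, t) * 2 ^ (s - t) ≤ stage (encode c) s x := by
        rw [stage, if_neg hx, ← hst]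
        exact Finset.le_sup (f := stageTerm (encode c) s x) (Finset.mem_range.2 hi)
      have hge' : (f (x, t) : ℝ) * 2 ^ (s - t) ≤ stage (encode c) s x := by exact_mod_cast hge
      rw [approx, le_div_iff₀ (by positivity)]
      refine le_trans ?_ hge'
      have h2 : (2 : ℝ) ^ s = 2 ^ t * 2 ^ (s - t) := by rw [← pow_add, Nat.add_sub_cancel' hts]
      rw [h2, ← mul_assoc]
      refine mul_le_mul_of_nonneg_right ?_ (by positivity)
      refine le_trans (le_of_eq ?_) (hf_ge x t)
      rw [sub_mul, ← mul_pow]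
      norm_num
    have hlim' : Tendsto (fun t => (g x t : ℝ) - (1 / 2) ^ t) atTop (𝓝 (C x)) := by
      simpa using (hlim x).sub
        (tendsto_pow_atTop_nhds_zero_of_lt_one (r := (1 / 2 : ℝ)) (by norm_num) (by norm_num))
    exact le_of_tendsto' hlim' hlow

/-- The weight `2⁻ᵉ⁻¹` of the `e`-th program. -/
noncomputable def weight (e : ℕ) : ℝ := 1 / 2 / 2 ^ e

theorem weight_pos (e : ℕ) : 0 < weight e := by
  unfold weight; positivity

theorem hasSum_weight : HasSum weight 1 := hasSum_geometric_two' 1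

/-- The weighted sum of all enumerated decreasing functions. -/
noncomputable def universalCumulative (x : List Bool) : ℝ := ∑' e, weight e * enumerated e x

theorem summable_weight_mul (x : List Bool) : Summable fun e => weight e * enumerated e x :=
  Summable.of_nonneg_of_le (fun e => mul_nonneg (weight_pos e).le (enumerated_nonneg e x))
    (fun e => mul_le_of_le_one_right (weight_pos e).le (enumerated_le_one e x))
    hasSum_weight.summable

theorem universalCumulative_nil : universalCumulative [] = 1 := by
  simp [universalCumulative, enumerated_nil, hasSum_weight.tsum_eq]

theorem le_universalCumulative (e : ℕ) (x : List Bool) :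
    weight e * enumerated e x ≤ universalCumulative x :=
  (summable_weight_mul x).le_tsum e fun i _ =>
    mul_nonneg (weight_pos i).le (enumerated_nonneg i x)

theorem weight_mul_sub_le (e : ℕ) {x y : List Bool} (h : lexLe x y) :
    weight e * enumerated e x - weight e * enumerated e y ≤
      universalCumulative x - universalCumulative y := by
  unfold universalCumulative
  rw [← (summable_weight_mul x).tsum_sub (summable_weight_mul y)]
  exact ((summable_weight_mul x).sub (summable_weight_mul y)).le_tsum e fun i _ =>
    sub_nonneg.2 (mul_le_mul_of_nonneg_left (enumerated_antitone i h) (weight_pos i).le)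

theorem universalCumulative_nonneg (x : List Bool) : 0 ≤ universalCumulative x :=
  (mul_nonneg (weight_pos 0).le (enumerated_nonneg 0 x)).trans (le_universalCumulative 0 x)

theorem universalCumulative_antitone {x y : List Bool} (h : lexLe x y) :
    universalCumulative y ≤ universalCumulative x := by
  have h₁ := weight_mul_sub_le 0 h
  have h₂ := mul_le_mul_of_nonneg_left (enumerated_antitone 0 h) (weight_pos 0).le
  linarith

/-- The rational approximations from below of `universalCumulative`. -/
noncomputable def universalApprox (x : List Bool) (s : ℕ) : ℚ :=
  ((∑ e ∈ Finset.range s, 2 ^ (s - (e + 1)) * stage e s x : ℕ) : ℚ) / (2 ^ (s + s) : ℕ)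

theorem computable₂_universalApprox : Computable₂ universalApprox := by
  refine Computable.rat_natCast_div
    (a := fun p : List Bool × ℕ =>
      ∑ e ∈ Finset.range p.2, 2 ^ (p.2 - (e + 1)) * stage e p.2 p.1)
    (b := fun p : List Bool × ℕ => 2 ^ (p.2 + p.2)) (Primrec.to_comp ?_) (Primrec.to_comp ?_)
    fun p => by positivity
  · refine Primrec.finset_sum_range ?_ Primrec.snd
    have hs : Primrec fun q : (List Bool × ℕ) × ℕ => q.1.2 := Primrec.snd.comp Primrec.fst
    exact Primrec.nat_mul.comp
      (Primrec.nat_two_pow.comp (Primrec.nat_sub.comp hs (Primrec.succ.comp Primrec.snd)))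
      (primrec_stage.comp ((Primrec.snd.pair hs).pair (Primrec.fst.comp Primrec.fst)))
  · exact Primrec.nat_two_pow.comp (Primrec.nat_add.comp Primrec.snd Primrec.snd)

theorem universalApprox_cast (x : List Bool) (s : ℕ) :
    (universalApprox x s : ℝ) = ∑ e ∈ Finset.range s, weight e * approx e x s := by
  unfold universalApprox
  push_cast
  rw [Finset.sum_div]
  refine Finset.sum_congr rfl fun e he => ?_
  obtain ⟨k, rfl⟩ := Nat.exists_eq_add_of_le (Nat.succ_le_of_lt (Finset.mem_range.1 he))
  rw [Nat.succ_eq_add_one, Nat.add_sub_cancel_left, weight, approx]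
  field_simp
  ring

theorem universalApprox_monotone (x : List Bool) : Monotone (universalApprox x) := by
  refine monotone_nat_of_le_succ fun s => ?_
  rw [← Rat.cast_le (K := ℝ), universalApprox_cast, universalApprox_cast, Finset.sum_range_succ]
  refine le_add_of_le_of_nonneg (Finset.sum_le_sum fun e _ =>
    mul_le_mul_of_nonneg_left (approx_monotone e x s.le_succ) (weight_pos e).le)
    (mul_nonneg (weight_pos s).le (approx_nonneg _ _ _))

theorem tendsto_universalApprox (x : List Bool) :
    Tendsto (fun s => (universalApprox x s : ℝ)) atTop (𝓝 (universalCumulative x)) := by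
  have h : Tendsto (fun s => ∑' e, if e < s then weight e * approx e x s else 0) atTop
      (𝓝 (universalCumulative x)) := by
    refine tendsto_tsum_of_dominated_convergence hasSum_weight.summable (fun e => ?_)
      (Eventually.of_forall fun s e => ?_)
    · refine ((tendsto_approx e x).const_mul (weight e)).congr' ?_
      filter_upwards [eventually_gt_atTop e] with s hs
      rw [if_pos hs]
    · split_ifs
      · rw [Real.norm_of_nonneg (mul_nonneg (weight_pos e).le (approx_nonneg e x s))]
        exact mul_le_of_le_one_right (weight_pos e).le (approx_le_one e x s)
      · simpa using (weight_pos e).le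
  refine h.congr fun s => ?_
  rw [universalApprox_cast, tsum_eq_sum (s := Finset.range s)
    fun e he => if_neg (Finset.mem_range.not.1 he)]
  exact Finset.sum_congr rfl fun e he => if_pos (Finset.mem_range.1 he)

/-- There is a universal cumulatively enumerable measure. -/
theorem exists_universal_CEM :
    ∃ μ₀ : List Bool → ℝ, IsCEM μ₀ ∧
      ∀ μ : List Bool → ℝ, IsCEM μ →
        ∃ c : ℝ, 0 < c ∧ ∀ x : List Bool, μ₀ x ≥ c * μ x := by
  refine ⟨fun x => ofCumulative x universalCumulative 0,
    ⟨isSemimeasure_ofCumulative universalCumulative_nil universalCumulative_nonneg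
      fun _ _ => universalCumulative_antitone, universalApprox, computable₂_universalApprox,
      fun x => ⟨universalApprox_monotone x, ?_⟩⟩, ?_⟩
  · rw [Cmu_ofCumulative, sub_zero]
    exact tendsto_universalApprox x
  · rintro μ ⟨⟨hnil, hnonneg, hadd⟩, g, hg, hlim⟩
    obtain ⟨e, he⟩ := exists_enumerated_eq ((Cmu_nil μ).trans hnil) (Cmu_nonneg hnonneg)
      (fun _ _ => Cmu_antitone hnonneg hadd) hg (fun x => (hlim x).1) fun x => (hlim x).2
    refine ⟨weight e, weight_pos e, fun x => ?_⟩
    have hrest : 0 ≤ ofCumulative x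
        (fun y => universalCumulative y - weight e * enumerated e y) 0 := by
      refine ofCumulative_nonneg (fun y z h => ?_) (fun y => ?_) x
      · linarith [weight_mul_sub_le e h]
      · linarith [le_universalCumulative e y]
    have hμ : ofCumulative x (enumerated e) 0 = μ x := by
      have h := ofCumulative_Cmu μ 0 x
      simp only [add_zero] at h
      rwa [funext he]
    have h := ofCumulative_add_smul (weight e) (enumerated e)
      (fun y => universalCumulative y - weight e * enumerated e y) 0 0 x
    simp only [add_sub_cancel, mul_zero, add_zero, hμ] at h
    change weight e * μ x ≤ ofCumulative x (fun y => universalCumulative y) 0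
    rw [h]
    linarith
end

section
/- There is no universal recursive semidistribution: for every computable function P₀ : ℕ → ℚ whose real-valued version is a semidistribution, there exists a computable Q : ℕ → ℚ whose real-valued version is a semidistribution such that no constant c > 0 satisfies P₀(x) ≥ c·Q(x) for all x. -/
open Filter Topology

/-- A semidistribution on ℕ: nonnegative with convergent total sum at most 1. -/
def IsSemidistribution (P : ℕ → ℝ) : Prop :=
  (∀ x, 0 ≤ P x) ∧ Summable P ∧ ∑' x, P x ≤ 1

namespace Rat

/-- The pairing code of the numerator and the denominator of a rational. The numbering of `ℚ` used
by computability theory enumerates the range of this code in increasing order. -/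
def pairCode (q : ℚ) : ℕ := Nat.pair (Encodable.encode q.num) q.den

theorem pairCode_injective : Function.Injective pairCode :=
  @Encodable.encode_injective ℚ instEncodable

theorem infinite_range_pairCode : (Set.range pairCode).Infinite :=
  Set.infinite_range_of_injective pairCode_injective

theorem pairCode_ofNat (n : ℕ) :
    pairCode (Denumerable.ofNat ℚ n) = Nat.nth (· ∈ Set.range pairCode) n := by
  let := @Encodable.decidableRangeEncode ℚ instEncodable
  have : Infinite (Set.range (@Encodable.encode ℚ instEncodable)) :=
    infinite_range_pairCode.to_subtype
  let e := @Encodable.equivRangeEncode ℚ instEncodable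
  have h : Denumerable.ofNat ℚ n = e.symm (Nat.Subtype.ofNat _ n) := by
    apply Option.some_injective
    rw [← Denumerable.decode_eq_ofNat]
    rfl
  have key := congrFun
    (Nat.nth_eq_orderIsoOfNat (p := (· ∈ Set.range pairCode)) infinite_range_pairCode) n
  rw [key, h]
  refine (congrArg Subtype.val (e.apply_symm_apply _)).trans ?_
  exact congrArg Subtype.val (Nat.Subtype.orderIsoOfNat_apply ..).symm

open Classical in
theorem encode_eq_count (q : ℚ) :
    @Encodable.encode ℚ Primcodable.toEncodable q = Nat.count (· ∈ Set.range pairCode) (pairCode q) := by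
  conv_rhs => rw [← Denumerable.ofNat_encode q, pairCode_ofNat]
  exact (Nat.count_nth (p := (· ∈ Set.range pairCode))
    fun hf => absurd hf infinite_range_pairCode).symm

theorem encode_int (n : ℤ) :
    Encodable.encode n = if 0 ≤ n then 2 * n.natAbs else 2 * n.natAbs - 1 := by
  cases n <;> rfl

theorem mem_range_pairCode {c : ℕ} :
    c ∈ Set.range pairCode ↔
      0 < c.unpair.2 ∧ Nat.Coprime ((c.unpair.1 + 1) / 2) c.unpair.2 := by
  constructor
  · rintro ⟨q, rfl⟩
    have h : (Encodable.encode q.num + 1) / 2 = q.num.natAbs := by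
      rw [encode_int]; split_ifs <;> omega
    simpa [pairCode, h] using ⟨q.den_pos, q.reduced⟩
  · rintro ⟨hd, hc⟩
    have h : (Denumerable.ofNat ℤ c.unpair.1).natAbs = (c.unpair.1 + 1) / 2 := by
      conv_rhs => rw [← Denumerable.encode_ofNat (α := ℤ) c.unpair.1]
      rw [show Encodable.encode (Denumerable.ofNat ℤ c.unpair.1) = _ from encode_int _]
      split_ifs <;> omega
    refine ⟨⟨Denumerable.ofNat ℤ c.unpair.1, c.unpair.2, hd.ne', h ▸ hc⟩, ?_⟩
    conv_rhs => rw [← Nat.pair_unpair c]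
    exact congrArg (Nat.pair · _) (Denumerable.encode_ofNat (α := ℤ) _)

end Rat

theorem Nat.coprime_iff_forall_lt {m n : ℕ} (hn : 0 < n) :
    m.Coprime n ↔ ∀ k < n + 1, m % k = 0 → n % k = 0 → k = 1 := by
  constructor
  · intro h k _ hm hn
    exact Nat.eq_one_of_dvd_coprimes h (Nat.dvd_of_mod_eq_zero hm) (Nat.dvd_of_mod_eq_zero hn)
  · intro h
    exact h _ (Nat.lt_succ_of_le (Nat.gcd_le_right m hn))
      (Nat.mod_eq_zero_of_dvd (Nat.gcd_dvd_left m n)) (Nat.mod_eq_zero_of_dvd (Nat.gcd_dvd_right m n))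

theorem Rat.primrecPred_mem_range_pairCode : PrimrecPred (· ∈ Set.range Rat.pairCode) := by
  have hu : Primrec fun c : ℕ => c.unpair := Primrec.unpair
  have hm {α} [Primcodable α] {f : α → ℕ} (hf : Primrec f) :
      Primrec fun a => ((f a).unpair.1 + 1) / 2 :=
    Primrec.nat_div.comp (Primrec.succ.comp (Primrec.fst.comp (hu.comp hf))) (Primrec.const 2)
  have hd {α} [Primcodable α] {f : α → ℕ} (hf : Primrec f) :
      Primrec fun a => (f a).unpair.2 := Primrec.snd.comp (hu.comp hf)
  have hR : PrimrecRel fun k c : ℕ =>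
      ¬ ((c.unpair.1 + 1) / 2 % k = 0 ∧ c.unpair.2 % k = 0 ∧ ¬ k = 1) := by
    refine PrimrecPred.not (.and ?_ (.and ?_ (.not ?_)))
    · exact Primrec.eq.comp (Primrec.nat_mod.comp (hm .snd) .fst) (.const 0)
    · exact Primrec.eq.comp (Primrec.nat_mod.comp (hd .snd) .fst) (.const 0)
    · exact Primrec.eq.comp .fst (.const 1)
  refine PrimrecPred.of_eq (PrimrecPred.and (Primrec.nat_lt.comp (.const 0) (hd .id))
    (hR.forall_lt.comp (Primrec.succ.comp (hd .id)) .id)) fun c => ?_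
  rw [Rat.mem_range_pairCode]
  refine and_congr_right fun h => ?_
  simp only [id] at h ⊢
  rw [Nat.coprime_iff_forall_lt h]
  simp only [not_and, not_not, Nat.succ_eq_add_one]

theorem Primrec.nat_count {p : ℕ → Prop} [DecidablePred p] (hp : PrimrecPred p) :
    Primrec (Nat.count p) :=
  (Primrec.list_length.comp ((Primrec.listFilter hp).comp Primrec.list_range)).of_eq fun n => by
    rw [Nat.count_eq_card_filter_range]
    rfl


theorem Computable.of_isLeast {α : Type*} [Primcodable α] {p : α → ℕ → Bool}
    (hp : Computable₂ p) {f : α → ℕ} (hf : ∀ a, IsLeast {m | p a m} (f a)) :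
    Computable f := by
  refine Partrec.of_eq_tot (Partrec.rfind hp.partrec₂) fun a => ?_
  rw [Nat.mem_rfind]
  refine ⟨Part.mem_some_iff.2 (hf a).1.symm, fun {m} hm => Part.mem_some_iff.2 ?_⟩
  exact (Bool.eq_false_iff.2 fun h => (hm.trans_le ((hf a).2 h)).false).symm

namespace Rat

theorem computable_pairCode : Computable pairCode := by
  classical
  have hc : Computable₂ fun (q : ℚ) (c : ℕ) =>
      decide (c ∈ Set.range pairCode) &&
        decide (Nat.count (· ∈ Set.range pairCode) c =
          @Encodable.encode ℚ Primcodable.toEncodable q) :=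
    (Primrec.and.comp (primrecPred_mem_range_pairCode.decide.comp Primrec.snd)
      (Primrec.eq.decide.comp ((Primrec.nat_count primrecPred_mem_range_pairCode).comp Primrec.snd)
        (Primrec.encode.comp Primrec.fst))).to_comp
  refine Computable.of_isLeast hc fun q => ⟨?_, fun c h => ?_⟩
  · simp only [Set.mem_ofPred_eq, Bool.and_eq_true, decide_eq_true_eq]
    exact ⟨Set.mem_range_self q, (encode_eq_count q).symm⟩
  · simp only [Set.mem_ofPred_eq, Bool.and_eq_true, decide_eq_true_eq] at h
    obtain ⟨⟨r, rfl⟩, h⟩ := h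
    rw [← encode_eq_count] at h
    rw [@Encodable.encode_injective ℚ Primcodable.toEncodable _ _ h]

theorem computable_of_pairCode {α : Type*} [Primcodable α] {f : α → ℚ}
    (hf : Computable fun a => pairCode (f a)) : Computable f := by
  classical
  refine Computable.encode_iff.1 ?_
  exact ((Primrec.nat_count primrecPred_mem_range_pairCode).to_comp.comp hf).of_eq
    fun a => (encode_eq_count _).symm

theorem computable_den : Computable Rat.den :=
  ((Primrec.snd.comp Primrec.unpair).to_comp.comp computable_pairCode).of_eq fun q => by
    simp [pairCode]

theorem computable_natAbs_num : Computable fun q : ℚ => q.num.natAbs :=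
  ((Primrec.nat_div.comp (Primrec.succ.comp (Primrec.fst.comp Primrec.unpair))
    (Primrec.const 2)).to_comp.comp computable_pairCode).of_eq fun q => by
    simp only [pairCode, Nat.unpair_pair, encode_int]
    split_ifs <;> omega

theorem computable_inv_natCast {α : Type*} [Primcodable α] {f : α → ℕ} (hf : Computable f)
    (hpos : ∀ a, 0 < f a) : Computable fun a => ((f a : ℚ))⁻¹ := by
  refine computable_of_pairCode ?_
  refine (Primrec₂.natPair.to_comp.comp (Computable.const (Encodable.encode (1 : ℤ))) hf).of_eq
    fun a => ?_
  rw [pairCode, inv_natCast_num_of_pos (hpos a), inv_natCast_den_of_pos (hpos a)]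

theorem natAbs_num_mul_le_den_iff {q : ℚ} (hq : 0 ≤ q) {k : ℕ} (hk : 0 < k) :
    q.num.natAbs * k ≤ q.den ↔ q ≤ (k : ℚ)⁻¹ := by
  have hd : (0 : ℚ) < q.den := by exact_mod_cast q.den_pos
  have hk' : (0 : ℚ) < k := by exact_mod_cast hk
  have hn : ((q.num.natAbs : ℕ) : ℚ) = q.num := by
    rw [Nat.cast_natAbs, abs_of_nonneg (num_nonneg.2 hq)]
  rw [← one_div, le_div_iff₀ hk']
  conv_rhs => rw [← num_div_den q, div_mul_eq_mul_div, div_le_one₀ hd, ← hn]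
  exact_mod_cast Iff.rfl

end Rat

theorem Primrec.nat_pow : Primrec₂ ((· ^ ·) : ℕ → ℕ → ℕ) :=
  Primrec₂.unpaired'.1 Nat.Primrec.pow

/-- There is no universal recursive semidistribution. -/
theorem no_universal_recursive_semidistribution
    (P₀ : ℕ → ℚ) (hP₀c : Computable P₀)
    (hP₀ : IsSemidistribution fun x => ((P₀ x : ℚ) : ℝ)) :
    ∃ Q : ℕ → ℚ, Computable Q ∧ (IsSemidistribution fun x => ((Q x : ℚ) : ℝ)) ∧
      ¬ ∃ c : ℝ, 0 < c ∧ ∀ x, ((P₀ x : ℚ) : ℝ) ≥ c * ((Q x : ℚ) : ℝ) := by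
  obtain ⟨hnonneg, hsum, -⟩ := hP₀
  have hnonneg' (x) : 0 ≤ P₀ x := Rat.cast_nonneg.1 (hnonneg x)
  have hex (n : ℕ) : ∃ m, (P₀ (Nat.pair n m)).num.natAbs * 4 ^ (n + 1) ≤
      (P₀ (Nat.pair n m)).den := by
    have hinj : Function.Injective (Nat.pair n) := fun a b h => (Nat.pair_eq_pair.1 h).2
    have hlim := (hsum.comp_injective hinj).tendsto_atTop_zero
    obtain ⟨m, hm⟩ := (hlim.eventually_le_const
      (show (0 : ℝ) < ((4 ^ (n + 1) : ℕ) : ℝ)⁻¹ by positivity)).exists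
    exact ⟨m, (Rat.natAbs_num_mul_le_den_iff (hnonneg' _) (by positivity)).2
      ((Rat.cast_le (K := ℝ)).1 (by simpa using hm))⟩
  let a (n : ℕ) : ℕ := Nat.find (hex n)
  have ha : Computable a := by
    have hpow : Computable₂ fun n _ : ℕ => 4 ^ (n + 1) :=
      (Primrec.nat_pow.comp (.const 4) (Primrec.succ.comp .fst)).to_comp
    have hP : Computable₂ fun n m : ℕ => P₀ (Nat.pair n m) :=
      hP₀c.comp Primrec₂.natPair.to_comp
    refine Computable.of_isLeast (p := fun n m => decide
      ((P₀ (Nat.pair n m)).num.natAbs * 4 ^ (n + 1) ≤ (P₀ (Nat.pair n m)).den)) ?_ fun n => ?_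
    · exact Primrec.nat_le.decide.to_comp.comp
        (Primrec.nat_mul.to_comp.comp (Rat.computable_natAbs_num.comp hP) hpow)
        (Rat.computable_den.comp hP)
    · simpa using Nat.isLeast_find (hex n)
  have hsmall (n : ℕ) : (P₀ (Nat.pair n (a n)) : ℝ) ≤ ((4 : ℝ) ^ (n + 1))⁻¹ := by
    have : P₀ (Nat.pair n (a n)) ≤ ((4 ^ (n + 1) : ℕ) : ℚ)⁻¹ :=
      (Rat.natAbs_num_mul_le_den_iff (hnonneg' _) (by positivity)).1 (Nat.find_spec (hex n))
    simpa using (Rat.cast_le (K := ℝ)).2 this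
  let Q (x : ℕ) : ℚ := bif decide (x.unpair.2 = a x.unpair.1) then
    ((2 ^ (x.unpair.1 + 1) : ℕ) : ℚ)⁻¹ else 0
  have hQa (n : ℕ) : (Q (Nat.pair n (a n)) : ℝ) = 1 / 2 / 2 ^ n := by
    simp [Q, pow_succ, div_eq_mul_inv, mul_comm]
  have hQs : HasSum (fun x => (Q x : ℝ)) 1 := by
    have hinj : Function.Injective fun n => Nat.pair n (a n) :=
      fun m n h => (Nat.pair_eq_pair.1 h).1
    refine (hinj.hasSum_iff fun x hx => ?_).1 ?_
    · have hne : x.unpair.2 ≠ a x.unpair.1 := fun h =>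
        hx ⟨x.unpair.1, by simp only [← h, Nat.pair_unpair]⟩
      simp [Q, hne]
    · simpa only [Function.comp_def, hQa] using hasSum_geometric_two' 1
  refine ⟨Q, ?_, ⟨fun x => ?_, hQs.summable, hQs.tsum_eq.le⟩, ?_⟩
  · have h₁ : Computable fun x : ℕ => x.unpair.1 := (Primrec.fst.comp Primrec.unpair).to_comp
    have h₂ : Computable fun x : ℕ => x.unpair.2 := (Primrec.snd.comp Primrec.unpair).to_comp
    exact Computable.cond (Primrec.eq.decide.to_comp.comp h₂ (ha.comp h₁))
      (Rat.computable_inv_natCast (Primrec.nat_pow.to_comp.comp (.const 2)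
        (Computable.succ.comp h₁)) fun _ => by positivity) (.const 0)
  · simp only [Q, Bool.cond_decide]
    split_ifs <;> positivity
  · rintro ⟨c, hc, h⟩
    obtain ⟨n, hn⟩ := exists_pow_lt_of_lt_one hc (show (1 / 2 : ℝ) < 1 by norm_num)
    have h' := (h (Nat.pair n (a n))).le.trans (hsmall n)
    rw [hQa] at h'
    have h2 : (0 : ℝ) < 2 ^ n := by positivity
    have h4 : ((4 : ℝ) ^ (n + 1)) = 4 * (2 ^ n * 2 ^ n) := by
      rw [pow_succ, ← mul_pow]; norm_num [mul_comm]
    rw [h4] at h'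
    rw [one_div, inv_pow, inv_lt_iff_one_lt_mul₀ h2] at hn
    field_simp at h'
    nlinarith
end

section
/- Kraft inequality: for every prefix-free set S of finite binary strings, the sum Σ_{p ∈ S} 2^{−|p|} (a tsum over the elements of S, |p| denoting the length of p) is at most 1. -/
/-- A set of finite binary strings is prefix-free if no element is a proper
prefix of another element. -/
def PrefixFree (S : Set (List Bool)) : Prop :=
  ∀ p ∈ S, ∀ q ∈ S, p <+: q → p = q

theorem PrefixFree.mono {S T : Set (List Bool)} (hT : PrefixFree T) (h : S ⊆ T) :
    PrefixFree S :=
  fun p hp q hq hpq => hT p (h hp) q (h hq) hpq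

theorem PrefixFree.uniquelyDecodable {S : Set (List Bool)} (hS : PrefixFree S)
    (hnil : [] ∉ S) : InformationTheory.UniquelyDecodable S := by
  intro L₁
  induction L₁ with
  | nil =>
    rintro (_ | ⟨w, L₂⟩) _ h₂ h
    · rfl
    · have hw : w = [] := by simp_all
      exact absurd (hw ▸ h₂ w (by simp)) hnil
  | cons v L₁ ih =>
    rintro (_ | ⟨w, L₂⟩) h₁ h₂ h
    · have hv : v = [] := by simp_all
      exact absurd (hv ▸ h₁ v (by simp)) hnil
    · rw [List.flatten_cons, List.flatten_cons] at h
      have hvS : v ∈ S := h₁ v (by simp)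
      have hwS : w ∈ S := h₂ w (by simp)
      have hvw : v = w := by
        rcases List.prefix_or_prefix_of_prefix (List.prefix_append v L₁.flatten)
          (h ▸ List.prefix_append w L₂.flatten) with hp | hp
        · exact hS v hvS w hwS hp
        · exact (hS w hwS v hvS hp).symm
      subst hvw
      rw [ih L₂ (fun x hx => h₁ x (by simp [hx])) (fun x hx => h₂ x (by simp [hx]))
        (List.append_cancel_left h)]

theorem PrefixFree.sum_le_one {F : Finset (List Bool)}
    (hF : PrefixFree (F : Set (List Bool))) :
    ∑ w ∈ F, ((1 : ℝ) / 2) ^ w.length ≤ 1 := by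
  by_cases hnil : [] ∈ F
  · have hF' : F = {[]} :=
      Finset.eq_singleton_iff_unique_mem.mpr
        ⟨hnil, fun w hw => (hF [] hnil w hw List.nil_prefix).symm⟩
    simp [hF']
  · simpa using InformationTheory.kraft_mcmillan_inequality
      (hF.uniquelyDecodable (by simpa using hnil))

/-- Kraft inequality: for a prefix-free set `S` of finite binary strings,
`Σ_{p ∈ S} 2^{−|p|} ≤ 1`. -/
theorem kraft_inequality (S : Set (List Bool)) (hS : PrefixFree S) :
    ∑' p : S, ((1 : ℝ) / 2) ^ (p : List Bool).length ≤ 1 := by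
  refine Real.tsum_le_of_sum_le (fun _ => by positivity) fun F => ?_
  have hF : PrefixFree (F.map (Function.Embedding.subtype (· ∈ S)) : Set (List Bool)) :=
    hS.mono (by simp)
  simpa using hF.sum_le_one
end

section
/- The values of a CEM are approximable: if μ is a semimeasure that is a CEM, then there exists a computable function f : List Bool → ℕ → ℚ such that for every finite binary string x, f(x, t) converges to μ(x) as t → ∞. -/
open Filter Topology

namespace CumulativeMeasure

/-! ### Computability of subtraction on the rationals -/

section Rat

open Encodable

/-- The code of a rational as the pair of its numerator and denominator. -/
def ratPairCode (q : ℚ) : ℕ := Nat.pair (encode q.num) q.den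

theorem encode_int_eq (n : ℤ) : encode n = 2 * n.toNat + (2 * (-n).toNat - 1) := by
  rcases n with n | n
  · change 2 * n = _
    simp
  · change 2 * n + 1 = _
    simp [Int.negSucc_eq]
    omega

theorem natAbs_eq_encode_int (n : ℤ) : n.natAbs = (encode n + 1) / 2 := by
  rw [encode_int_eq]
  omega

theorem primrec_coprime_unpair :
    PrimrecPred fun m : ℕ => 0 < m.unpair.2 ∧ ((m.unpair.1 + 1) / 2).Coprime m.unpair.2 := by
  have hdvd : PrimrecRel fun (k : ℕ) (m : ℕ) =>
      k = 1 ∨ ¬ (((m.unpair.1 + 1) / 2) % k = 0 ∧ m.unpair.2 % k = 0) := by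
    have hk : Primrec fun p : ℕ × ℕ => p.1 := Primrec.fst
    have hn : Primrec fun p : ℕ × ℕ => (p.2.unpair.1 + 1) / 2 :=
      Primrec.nat_div.comp
        (Primrec.succ.comp (Primrec.fst.comp (Primrec.unpair.comp Primrec.snd))) (Primrec.const 2)
    have hd : Primrec fun p : ℕ × ℕ => p.2.unpair.2 :=
      Primrec.snd.comp (Primrec.unpair.comp Primrec.snd)
    exact (Primrec.eq.comp hk (Primrec.const 1)).or
      (((Primrec.eq.comp (Primrec.nat_mod.comp hn hk) (Primrec.const 0)).and
        (Primrec.eq.comp (Primrec.nat_mod.comp hd hk) (Primrec.const 0))).not)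
  have hden : Primrec fun m : ℕ => m.unpair.2 := Primrec.snd.comp Primrec.unpair
  refine ((Primrec.nat_lt.comp (Primrec.const 0) hden).and
    (hdvd.forall_lt.comp (Primrec.succ.comp hden) Primrec.id)).of_eq fun m => ?_
  refine and_congr_right fun hpos => ?_
  constructor
  · intro h
    rcases h (Nat.gcd ((m.unpair.1 + 1) / 2) m.unpair.2)
      (Nat.lt_succ_of_le (Nat.gcd_le_right _ hpos)) with h' | h'
    · exact h'
    · exact absurd ⟨Nat.mod_eq_zero_of_dvd (Nat.gcd_dvd_left _ _),
        Nat.mod_eq_zero_of_dvd (Nat.gcd_dvd_right _ _)⟩ h'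
  · intro h k _
    by_contra! hk
    exact hk.1 (Nat.eq_one_of_dvd_coprimes h (Nat.dvd_of_mod_eq_zero hk.2.1)
      (Nat.dvd_of_mod_eq_zero hk.2.2))

theorem mem_range_ratPairCode (m : ℕ) : m ∈ Set.range ratPairCode ↔
    0 < m.unpair.2 ∧ ((m.unpair.1 + 1) / 2).Coprime m.unpair.2 := by
  constructor
  · rintro ⟨q, rfl⟩
    simp only [ratPairCode, Nat.unpair_pair, ← natAbs_eq_encode_int]
    exact ⟨q.pos, q.reduced⟩
  · rintro ⟨hpos, hcop⟩
    have hn : encode (Denumerable.ofNat ℤ m.unpair.1) = m.unpair.1 := Denumerable.encode_ofNat _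
    refine ⟨⟨Denumerable.ofNat ℤ m.unpair.1, m.unpair.2, hpos.ne', ?_⟩, ?_⟩
    · rwa [natAbs_eq_encode_int, hn]
    · exact (congrArg (Nat.pair · m.unpair.2) hn).trans (Nat.pair_unpair m)

/-- The default enumeration of `ℚ` ranks the rationals by their pair codes. -/
theorem encode_rat_eq_length_filter (q : ℚ) :
    @encode ℚ Rat.instDenumerable.toEncodable q = ((List.range (ratPairCode q)).filter fun m =>
      decide (0 < m.unpair.2 ∧ ((m.unpair.1 + 1) / 2).Coprime m.unpair.2)).length := by
  have h : @encode ℚ Rat.instDenumerable.toEncodable q =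
      @List.countP ℕ (fun m => @decide (m ∈ Set.range ratPairCode) (decidableRangeEncode ℚ m))
        (List.range (ratPairCode q)) := rfl
  rw [h, List.countP_eq_length_filter]
  congr 2
  funext m
  exact decide_eq_decide.2 (mem_range_ratPairCode m)

theorem computable_of_decide_eq {α : Type*} [Primcodable α] {f : α → ℕ}
    (h : Computable₂ fun a n => decide (f a = n)) : Computable f := by
  refine Partrec.of_eq_tot (Partrec.rfind (p := fun a n => Part.some (decide (f a = n))) h) ?_
  refine fun a => Nat.mem_rfind.2 ⟨by simp, fun {m} hm => ?_⟩
  simp [hm.ne']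

theorem computable_ratPairCode : Computable ratPairCode := by
  have hcount : Primrec fun n : ℕ => ((List.range n).filter fun m =>
      decide (0 < m.unpair.2 ∧ ((m.unpair.1 + 1) / 2).Coprime m.unpair.2)).length :=
    Primrec.list_length.comp ((Primrec.listFilter primrec_coprime_unpair).comp Primrec.list_range)
  have hrel : PrimrecRel fun (q : ℚ) (n : ℕ) =>
      (0 < n.unpair.2 ∧ ((n.unpair.1 + 1) / 2).Coprime n.unpair.2) ∧
      ((List.range n).filter fun m =>
        decide (0 < m.unpair.2 ∧ ((m.unpair.1 + 1) / 2).Coprime m.unpair.2)).length =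
        @encode ℚ Rat.instDenumerable.toEncodable q :=
    (primrec_coprime_unpair.comp Primrec.snd).and
      (Primrec.eq.comp (hcount.comp Primrec.snd) (Primrec.encode.comp Primrec.fst))
  have hgraph : PrimrecRel fun (q : ℚ) (n : ℕ) => ratPairCode q = n := by
    refine hrel.of_eq fun q n => ?_
    rw [← mem_range_ratPairCode]
    constructor
    · rintro ⟨⟨p, rfl⟩, h⟩
      rw [← encode_rat_eq_length_filter] at h
      rw [@encode_injective ℚ Rat.instDenumerable.toEncodable _ _ h]
    · rintro rfl
      exact ⟨⟨q, rfl⟩, (encode_rat_eq_length_filter q).symm⟩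
  exact computable_of_decide_eq hgraph.decide.to_comp

theorem computable_den : Computable fun q : ℚ => q.den := by
  refine ((Primrec.snd.comp Primrec.unpair).to_comp.comp computable_ratPairCode).of_eq fun q => ?_
  simp [ratPairCode]

theorem computable_num_toNat : Computable fun q : ℚ => q.num.toNat := by
  have h : Primrec fun m : ℕ => (1 - m.unpair.1 % 2) * (m.unpair.1 / 2) := by
    have hn : Primrec fun m : ℕ => m.unpair.1 := Primrec.fst.comp Primrec.unpair
    exact Primrec.nat_mul.comp
      (Primrec.nat_sub.comp (Primrec.const 1) (Primrec.nat_mod.comp hn (Primrec.const 2)))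
      (Primrec.nat_div.comp hn (Primrec.const 2))
  refine (h.to_comp.comp computable_ratPairCode).of_eq fun q => ?_
  simp only [ratPairCode, Nat.unpair_pair, encode_int_eq]
  rcases le_or_gt 0 q.num with hq | hq
  · have h0 : (-q.num).toNat = 0 := by omega
    simp [h0]
  · have h1 : (2 * q.num.toNat + (2 * (-q.num).toNat - 1)) % 2 = 1 := by omega
    rw [h1]
    omega

theorem computable_neg_num_toNat : Computable fun q : ℚ => (-q.num).toNat := by
  have h : Primrec fun m : ℕ => (m.unpair.1 % 2) * ((m.unpair.1 + 1) / 2) := by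
    have hn : Primrec fun m : ℕ => m.unpair.1 := Primrec.fst.comp Primrec.unpair
    exact Primrec.nat_mul.comp (Primrec.nat_mod.comp hn (Primrec.const 2))
      (Primrec.nat_div.comp (Primrec.succ.comp hn) (Primrec.const 2))
  refine (h.to_comp.comp computable_ratPairCode).of_eq fun q => ?_
  simp only [ratPairCode, Nat.unpair_pair, encode_int_eq]
  rcases le_or_gt 0 q.num with hq | hq
  · have h0 : (-q.num).toNat = 0 := by omega
    simp [h0]
  · have h1 : (2 * q.num.toNat + (2 * (-q.num).toNat - 1)) % 2 = 1 := by omega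
    rw [h1]
    omega

theorem rat_sub_eq_iff (p q r : ℚ) : p - q = r ↔
    p.num.toNat * (q.den * r.den) + (-q.num).toNat * (p.den * r.den)
        + (-r.num).toNat * (p.den * q.den) =
      (-p.num).toNat * (q.den * r.den) + q.num.toNat * (p.den * r.den)
        + r.num.toNat * (p.den * q.den) := by
  have key (x : ℚ) : x = ((x.num.toNat : ℚ) - ((-x.num).toNat : ℚ)) / (x.den : ℚ) := by
    have h : (x.num.toNat : ℤ) - ((-x.num).toNat : ℤ) = x.num := by omega
    have h' : (x.num.toNat : ℚ) - ((-x.num).toNat : ℚ) = (x.num : ℚ) := by exact_mod_cast h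
    rw [h', Rat.num_div_den]
  have hp : (p.den : ℚ) ≠ 0 := by exact_mod_cast p.den_nz
  have hq : (q.den : ℚ) ≠ 0 := by exact_mod_cast q.den_nz
  have hr : (r.den : ℚ) ≠ 0 := by exact_mod_cast r.den_nz
  have hsub : p - q = r ↔
      ((p.num.toNat : ℚ) - (-p.num).toNat) / p.den - ((q.num.toNat : ℚ) - (-q.num).toNat) / q.den =
        ((r.num.toNat : ℚ) - (-r.num).toNat) / r.den := by
    rw [← key p, ← key q, ← key r]
  rw [hsub, ← Nat.cast_inj (R := ℚ), div_sub_div _ _ hp hq, div_eq_div_iff (mul_ne_zero hp hq) hr]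
  push_cast
  constructor <;> intro h <;> linear_combination h

theorem computable_rat_sub : Computable₂ fun p q : ℚ => p - q := by
  have hgraph : Computable₂ fun (x : ℚ × ℚ) (n : ℕ) =>
      decide (@encode ℚ Rat.instDenumerable.toEncodable (x.1 - x.2) = n) := by
    have hp : Computable fun x : (ℚ × ℚ) × ℕ => x.1.1 := Computable.fst.comp Computable.fst
    have hq : Computable fun x : (ℚ × ℚ) × ℕ => x.1.2 := Computable.snd.comp Computable.fst
    have hr : Computable fun x : (ℚ × ℚ) × ℕ => Denumerable.ofNat ℚ x.2 :=
      (Computable.ofNat ℚ).comp Computable.snd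
    have hmul := Primrec.nat_mul.to_comp
    have hadd := Primrec.nat_add.to_comp
    have hqr := hmul.comp (computable_den.comp hq) (computable_den.comp hr)
    have hpr := hmul.comp (computable_den.comp hp) (computable_den.comp hr)
    have hpq := hmul.comp (computable_den.comp hp) (computable_den.comp hq)
    have hlhs := hadd.comp (hadd.comp
      (hmul.comp (computable_num_toNat.comp hp) hqr)
      (hmul.comp (computable_neg_num_toNat.comp hq) hpr))
      (hmul.comp (computable_neg_num_toNat.comp hr) hpq)
    have hrhs := hadd.comp (hadd.comp
      (hmul.comp (computable_neg_num_toNat.comp hp) hqr)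
      (hmul.comp (computable_num_toNat.comp hq) hpr))
      (hmul.comp (computable_num_toNat.comp hr) hpq)
    refine ((Primrec.eq (α := ℕ)).decide.to_comp.comp hlhs hrhs).of_eq fun x => ?_
    refine decide_eq_decide.2 ((rat_sub_eq_iff _ _ _).symm.trans ?_)
    constructor
    · intro h
      rw [h]
      exact Denumerable.encode_ofNat _
    · intro h
      rw [← h]
      exact (Denumerable.ofNat_encode _).symm
  exact Computable.encode_iff.1 (computable_of_decide_eq hgraph)

end Rat

/-! ### The cumulative measure by recursion on the string -/

theorem hasSum_list_bool {F : List Bool → ℝ} {a b : ℝ}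
    (ha : HasSum (fun y => F (false :: y)) a) (hb : HasSum (fun y => F (true :: y)) b) :
    HasSum F (F [] + a + b) := by
  let E (c : Bool) (y : List Bool) : ℝ := if y.head? = some c then F y else 0
  have hE (c : Bool) {s : ℝ} (hs : HasSum (fun y => F (c :: y)) s) : HasSum (E c) s := by
    refine ((List.cons_injective (a := c)).hasSum_iff ?_).1 ?_
    · rintro (_ | ⟨d, y⟩) hy
      · simp [E]
      · have : d ≠ c := by rintro rfl; exact hy ⟨y, rfl⟩
        simp [E, this]
    · convert hs using 2 with y
      simp [E]
  have h0 : HasSum (fun y : List Bool => if y = [] then F [] else 0) (F []) :=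
    hasSum_ite_eq [] (F [])
  convert (h0.add (hE false ha)).add (hE true hb) using 2 with y
  rcases y with _ | ⟨_ | _, y⟩ <;> simp [E]

/-- The summand of the total mass of `μ` at level `n`. -/
noncomputable def levelTerm (μ : List Bool → ℝ) (n : ℕ) (y : List Bool) : ℝ :=
  if y.length = n then μ y else if y.length < n then mubar μ y else 0

open Classical in
/-- The summand of the cumulative measure of `x`. -/
noncomputable def cumTerm (μ : List Bool → ℝ) (x y : List Bool) : ℝ :=
  if y.length = x.length ∧ lexLe x y then μ y
  else if y.length < x.length ∧ lexLt x y then mubar μ y else 0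

/-- The cumulative measure of a string, by recursion on the string. -/
def cumRec : (List Bool → ℝ) → List Bool → ℝ
  | μ, [] => μ []
  | μ, false :: x => cumRec (fun y => μ (false :: y)) x + μ [true]
  | μ, true :: x => cumRec (fun y => μ (true :: y)) x

theorem hasSum_levelTerm (μ : List Bool → ℝ) (n : ℕ) : HasSum (levelTerm μ n) (μ []) := by
  induction n generalizing μ with
  | zero =>
    convert hasSum_ite_eq ([] : List Bool) (μ []) using 2 with y
    rcases y with _ | ⟨b, y⟩ <;> simp [levelTerm]
  | succ n ih =>
    have h (b : Bool) : (fun y => levelTerm μ (n + 1) (b :: y)) =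
        levelTerm (fun y => μ (b :: y)) n := by
      funext y
      simp [levelTerm, mubar]
    have := hasSum_list_bool (F := levelTerm μ (n + 1)) (h false ▸ ih _) (h true ▸ ih _)
    convert this using 1
    simp only [levelTerm, mubar, List.length_nil, List.nil_append]
    rw [if_neg (by omega), if_pos (by omega)]
    ring

theorem hasSum_cumTerm (μ : List Bool → ℝ) (x : List Bool) :
    HasSum (cumTerm μ x) (cumRec μ x) := by
  induction x generalizing μ with
  | nil =>
    rw [cumRec]
    convert hasSum_ite_eq ([] : List Bool) (μ []) using 2 with y
    rcases y with _ | ⟨b, y⟩ <;> simp [cumTerm, lexLe]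
  | cons b x ih =>
    have hnil : cumTerm μ (b :: x) [] = 0 := by simp [cumTerm, lexLt]
    have hsame : (fun y => cumTerm μ (b :: x) (b :: y)) = cumTerm (fun y => μ (b :: y)) x := by
      funext y
      have hlt : lexLt (b :: x) (b :: y) ↔ lexLt x y := by cases b <;> simp [lexLt]
      have hle : lexLe (b :: x) (b :: y) ↔ lexLe x y := by simp [lexLe, hlt]
      classical
      exact if_congr (by simp [hle]) rfl (if_congr (by simp [hlt]) rfl rfl)
    have hsum : HasSum (fun y => cumTerm μ (b :: x) (b :: y))
        (cumRec (fun y => μ (b :: y)) x) := hsame ▸ ih _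
    cases b
    · have hother : (fun y => cumTerm μ (false :: x) (true :: y)) =
          levelTerm (fun y => μ (true :: y)) x.length := by
        funext y
        simp [cumTerm, levelTerm, mubar, lexLe, lexLt]
      have := hasSum_list_bool hsum (hother ▸ hasSum_levelTerm _ _)
      rwa [hnil, zero_add] at this
    · have hother : (fun y => cumTerm μ (true :: x) (false :: y)) = fun _ => 0 := by
        funext y
        simp [cumTerm, lexLe, lexLt]
      have := hasSum_list_bool (hother ▸ hasSum_zero) hsum
      rwa [hnil, zero_add, zero_add] at this

theorem Cmu_eq_cumRec (μ : List Bool → ℝ) (x : List Bool) : Cmu μ x = cumRec μ x := by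
  have hfin : {y : List Bool | y.length < x.length + 1}.Finite := List.finite_length_lt Bool _
  rw [← (hasSum_cumTerm μ x).tsum_eq, Cmu]
  have h1 := tsum_subtype {y : List Bool | y.length = x.length ∧ lexLe x y} μ
  have h2 := tsum_subtype {y : List Bool | y.length < x.length ∧ lexLt x y} (mubar μ)
  refine (congrArg₂ (· + ·) h1 h2).trans ?_
  rw [← Summable.tsum_add]
  · congr 1
    funext y
    classical
    rw [Set.indicator_apply, Set.indicator_apply, cumTerm]
    by_cases hy : y.length = x.length <;> simp [hy]
  · refine summable_of_hasFiniteSupport (hfin.subset fun y hy => ?_)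
    have := Set.mem_of_indicator_ne_zero hy
    simp only [Set.mem_ofPred_eq] at this ⊢
    omega
  · refine summable_of_hasFiniteSupport (hfin.subset fun y hy => ?_)
    have := Set.mem_of_indicator_ne_zero hy
    simp only [Set.mem_ofPred_eq] at this ⊢
    omega

/-! ### The string following a cylinder -/

/-- The least string above all extensions of `x`: it is `z1` for `x = z01ᵏ`,
and does not exist for `x = 1ᵏ`. -/
def cylinderSucc (x : List Bool) : Option (List Bool) :=
  x.foldr (fun b o => o.casesOn (bif b then none else some [true]) fun y => some (b :: y)) none

theorem primrec_cylinderSucc : Primrec cylinderSucc := by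
  have hstep : Primrec₂ fun (_ : List Bool) (p : Bool × Option (List Bool)) =>
      (p.2.casesOn (bif p.1 then none else some [true]) fun y => some (p.1 :: y) :
        Option (List Bool)) :=
    Primrec.option_casesOn (Primrec.snd.comp Primrec.snd)
      (Primrec.cond (Primrec.fst.comp Primrec.snd) (Primrec.const _) (Primrec.const _))
      (Primrec.option_some.comp (Primrec.list_cons.comp
        (Primrec.fst.comp (Primrec.snd.comp Primrec.fst)) Primrec.snd))
  exact Primrec.list_foldr Primrec.id (Primrec.const none) hstep

theorem cumRec_sub_cylinderSucc (μ : List Bool → ℝ) (x : List Bool) :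
    cumRec μ x - (cylinderSucc x).elim 0 (cumRec μ) = μ x := by
  induction x generalizing μ with
  | nil => simp [cumRec, cylinderSucc]
  | cons b x ih =>
    have ih := ih fun y => μ (b :: y)
    have hcons : cylinderSucc (b :: x) = (cylinderSucc x).casesOn
      (bif b then none else some [true]) fun y => some (b :: y) := rfl
    rw [hcons]
    cases hx : cylinderSucc x <;> cases b <;> simp_all [cumRec]

end CumulativeMeasure

open CumulativeMeasure

/-- The values of a CEM are approximable: some computable `ℚ`-valued function
converges to `μ x` for every `x`. -/
theorem CEM_values_approximable (μ : List Bool → ℝ) (hμ : IsCEM μ) :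
    ∃ f : List Bool → ℕ → ℚ, Computable₂ f ∧
      ∀ x : List Bool,
        Tendsto (fun t => ((f x t : ℚ) : ℝ)) atTop (𝓝 (μ x)) := by
  obtain ⟨-, g, hg, hlim⟩ := hμ
  refine ⟨fun x t => g x t - (cylinderSucc x).elim 0 fun y => g y t, ?_, fun x => ?_⟩
  · refine computable_rat_sub.comp hg ?_
    refine (Computable.option_casesOn (primrec_cylinderSucc.to_comp.comp Computable.fst)
      (Computable.const (0 : ℚ)) (hg.comp Computable.snd
        (Computable.snd.comp Computable.fst)).to₂).of_eq fun p => ?_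
    cases cylinderSucc p.1 <;> rfl
  · rw [← cumRec_sub_cylinderSucc μ x]
    have hx (y : List Bool) : Tendsto (fun t => ((g y t : ℚ) : ℝ)) atTop (𝓝 (cumRec μ y)) :=
      Cmu_eq_cumRec μ y ▸ (hlim y).2
    push_cast
    refine (hx x).sub ?_
    cases cylinderSucc x with
    | none => simp
    | some y => exact hx y
end
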